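/- Let d = 1 and p = p_c. If at least two of the three limits ρ = lim_{t→∞} (−log θ_t)/(log t), η = lim_{t→∞} (log χ_t)/(log t), ν = lim_{t→∞} (log ξ_t)/(log t) exist as real numbers, then the third limit also exists and ν = η + 2ρ. -/

import Mathlib

/-!
Common set-up: nearest-neighbour oriented bond percolation on the space-time
lattice `ℤ^d × ℕ`.  A (potential) bond is a pair `((x, s), y)`, representing
the oriented bond from `(x, s)` to `(y, s + 1)` (it is a genuine bond when
`‖x - y‖₁ = 1`).  Each bond is occupied (`true`) with probability `p`,
independently of all other bonds.  The product Bernoulli(`p`) measure on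
configurations is constructed explicitly as the pushforward of the uniform
measure on `[0,1)`: the binary digits of a uniform sample are i.i.d. fair
coin flips, which are re-packed (via the pairing function) into an i.i.d.
sequence of uniform random variables `unif i`, one for each bond, and the
bond indexed by `i` is occupied exactly when `unif i < p`.
-/

open MeasureTheory Filter Set
open scoped Classical ENNReal Topology

namespace OrientedPercolation

/-- A potential bond of the `d`-dimensional space-time lattice: `((x, s), y)`
represents the oriented pair from `(x, s)` to `(y, s + 1)`. -/
abbrev Bond (d : ℕ) := ((Fin d → ℤ) × ℕ) × (Fin d → ℤ)

/-- A bond configuration: each potential bond is occupied (`true`) or vacant (`false`). -/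
abbrev Config (d : ℕ) := Bond d → Bool

/-- The ℓ¹-norm of a point of `ℤ^d`. -/
def norm1 {d : ℕ} (x : Fin d → ℤ) : ℤ := ∑ i, |x i|

/-- The squared Euclidean norm of a point of `ℤ^d`. -/
def normSq {d : ℕ} (x : Fin d → ℤ) : ℤ := ∑ i, (x i) ^ 2

/-- The `n`-th binary digit of `x ∈ [0,1)`. -/
noncomputable def digit (n : ℕ) (x : ℝ) : ℕ := ⌊x * 2 ^ (n + 1)⌋.toNat % 2

/-- From a single uniform sample on `[0,1)`, an i.i.d. sequence of uniform
samples on `[0,1]`, obtained by splitting the binary digits via the pairing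
function. -/
noncomputable def unif (i : ℕ) (x : ℝ) : ℝ :=
  ∑' k : ℕ, (digit (Nat.pair i k) x : ℝ) / 2 ^ (k + 1)

/-- An injective encoding of the bonds by natural numbers. -/
noncomputable def enc (d : ℕ) : Bond d → ℕ := (exists_injective_nat (Bond d)).choose

/-- The i.i.d. Bernoulli(`p`) bond configuration built from a uniform sample `x`. -/
noncomputable def config (d : ℕ) (p : ℝ) (x : ℝ) : Config d :=
  fun b => if unif (enc d b) x < p then true else false

/-- The product Bernoulli(`p`) measure `ℙ_p` on bond configurations. -/
noncomputable def P (d : ℕ) (p : ℝ) : Measure (Config d) :=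
  Measure.map (config d p) ((volume : Measure ℝ).restrict (Set.Ico 0 1))

/-- `ConnectedIn ω R x s y t` : either `(x,s) = (y,t) ∈ R`, or there is a path of
occupied bonds from `(x, s)` to `(y, t)`, all of whose vertices lie in `R`. -/
def ConnectedIn {d : ℕ} (ω : Config d) (R : Set ((Fin d → ℤ) × ℕ))
    (x : Fin d → ℤ) (s : ℕ) (y : Fin d → ℤ) (t : ℕ) : Prop :=
  (x = y ∧ s = t ∧ (x, s) ∈ R) ∨
  (s < t ∧ ∃ v : ℕ → (Fin d → ℤ), v s = x ∧ v t = y ∧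
    (∀ j, s ≤ j → j ≤ t → (v j, j) ∈ R) ∧
    (∀ j, s ≤ j → j < t → norm1 (v (j + 1) - v j) = 1 ∧ ω ((v j, j), v (j + 1)) = true))

/-- `(x, s) → (y, t)` : `(x,s) = (y,t)` or there is a path of occupied bonds from
`(x, s)` to `(y, t)`. -/
def Connected {d : ℕ} (ω : Config d) (x : Fin d → ℤ) (s : ℕ) (y : Fin d → ℤ) (t : ℕ) : Prop :=
  ConnectedIn ω Set.univ x s y t

/-- The survival probability `θ_t = ℙ_p((o,0) → t)`. -/
noncomputable def theta (d : ℕ) (p : ℝ) (t : ℕ) : ℝ :=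
  (P d p {ω | ∃ y, Connected ω 0 0 y t}).toReal

/-- The two-point function `τ(x,t) = ℙ_p((o,0) → (x,t))`. -/
noncomputable def tau (d : ℕ) (p : ℝ) (x : Fin d → ℤ) (t : ℕ) : ℝ :=
  (P d p {ω | Connected ω 0 0 x t}).toReal

/-- The expected number of vertices at time `t` connected from the origin,
`χ_t = Σ_x τ(x,t)`. -/
noncomputable def chi (d : ℕ) (p : ℝ) (t : ℕ) : ℝ := ∑' x : Fin d → ℤ, tau d p x t

/-- The gyration radius `ξ_t = (χ_t⁻¹ Σ_x |x|² τ(x,t))^(1/2)`. -/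
noncomputable def xi (d : ℕ) (p : ℝ) (t : ℕ) : ℝ :=
  Real.sqrt ((∑' x : Fin d → ℤ, (normSq x : ℝ) * tau d p x t) / chi d p t)

/-- The critical point `p_c = inf {p ∈ [0,1] : θ_∞ > 0}` (here `θ_∞ = lim_t θ_t = inf_t θ_t`,
since `θ_t` is nonincreasing in `t` and nonnegative). -/
noncomputable def pc (d : ℕ) : ℝ :=
  sInf {p ∈ Set.Icc (0 : ℝ) 1 | 0 < ⨅ t : ℕ, theta d p t}

/-- The rectangle `[a, b] × [0, t]` (for `d = 1`). -/
def rect (a b : ℤ) (t : ℕ) : Set ((Fin 1 → ℤ) × ℕ) :=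
  {v | a ≤ v.1 0 ∧ v.1 0 ≤ b ∧ v.2 ≤ t}

/-- The rectangle `[a, b] × [0, t]` is crossed vertically: there is a path of occupied
bonds inside the rectangle from some vertex `(x, 0)` to some vertex `(y, t)`. -/
def CrossedVert (ω : Config 1) (a b : ℤ) (t : ℕ) : Prop :=
  ∃ x y : Fin 1 → ℤ, ConnectedIn ω (rect a b t) x 0 y t

/-- The rectangle `[a, b] × [0, t]` is crossed from left to right: there is a path of
occupied bonds inside the rectangle containing a vertex with first coordinate `a` and
a vertex with first coordinate `b`. -/
def CrossedHoriz (ω : Config 1) (a b : ℤ) (t : ℕ) : Prop :=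
  ∃ (x y : Fin 1 → ℤ) (s u : ℕ), x 0 = a ∧ y 0 = b ∧
    (ConnectedIn ω (rect a b t) x s y u ∨ ConnectedIn ω (rect a b t) y u x s)

/-- `V_p(w, t) = ℙ_p([0,w] × [0,t] is crossed vertically)`. -/
noncomputable def V (p : ℝ) (w : ℕ) (t : ℕ) : ℝ :=
  (P 1 p {ω | CrossedVert ω 0 w t}).toReal

/-- `H_p(w, t) = ℙ_p([0,w] × [0,t] is crossed from left to right)`. -/
noncomputable def H (p : ℝ) (w : ℕ) (t : ℕ) : ℝ :=
  (P 1 p {ω | CrossedHoriz ω 0 w t}).toReal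

/-- The event that `(o, 0)` is connected, inside the box `B_o = [-w,w] × [0,t]`, to the
boundary `∂B_o = {(x,s) ∈ B_o : s = t or |x| = w}`. -/
def ToBoundary (ω : Config 1) (w : ℕ) (t : ℕ) : Prop :=
  ∃ (y : Fin 1 → ℤ) (s : ℕ), (s = t ∨ |y 0| = w) ∧
    ConnectedIn ω (rect (-(w : ℤ)) w t) 0 0 y s

/-! ### Identification of the measure -/

/-- uniform measure on `[0,1)` -/
noncomputable abbrev uni : Measure ℝ := (volume : Measure ℝ).restrict (Set.Ico 0 1)

instance uni_prob : IsProbabilityMeasure uni := ⟨by simp [uni]⟩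

/-- digits as booleans -/
noncomputable def dg (x : ℝ) (k : ℕ) : Bool := decide (digit k x = 1)

/-- fair coin -/
noncomputable def coin : Measure Bool := uni.map (fun x => dg x 0)

lemma floor_succ (x : ℝ) (n : ℕ) (hx : 0 ≤ x) :
    ⌊x * 2 ^ (n+1)⌋.toNat = 2 * ⌊x * 2 ^ n⌋.toNat + digit n x := by
  have h0 : ∀ m : ℕ, (0:ℤ) ≤ ⌊x * 2 ^ m⌋ := fun m => Int.floor_nonneg.2 (by positivity)
  have h : ⌊x * 2 ^ (n+1)⌋ = 2 * ⌊x * 2 ^ n⌋ ∨ ⌊x * 2 ^ (n+1)⌋ = 2 * ⌊x * 2 ^ n⌋ + 1 := by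
    have h1 := Int.floor_le (x * 2 ^ n)
    have h2 := Int.lt_floor_add_one (x * 2 ^ n)
    have h3 := Int.floor_le (x * 2 ^ (n+1))
    have h4 := Int.lt_floor_add_one (x * 2 ^ (n+1))
    have e : x * 2 ^ (n+1) = 2 * (x * 2^n) := by ring
    rw [e] at h3 h4 ⊢
    have a : 2 * ⌊x * 2 ^ n⌋ < ⌊2 * (x * 2 ^ n)⌋ + 1 := by
      have : (2 * ⌊x * 2 ^ n⌋ : ℝ) < ⌊2 * (x * 2 ^ n)⌋ + 1 := by linarith
      exact_mod_cast this
    have b : ⌊2 * (x * 2 ^ n)⌋ < 2 * ⌊x * 2 ^ n⌋ + 2 := by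
      have : (⌊2 * (x * 2 ^ n)⌋ : ℝ) < 2 * ⌊x * 2 ^ n⌋ + 2 := by linarith
      exact_mod_cast this
    omega
  unfold digit
  have := h0 n
  have := h0 (n+1)
  omega

lemma digit_lt (n : ℕ) (x : ℝ) : digit n x < 2 := Nat.mod_lt _ (by norm_num)

/-- number with given leading binary digits -/
def binA (c : ℕ → Bool) : ℕ → ℕ
  | 0 => 0
  | n+1 => 2 * binA c n + (c n).toNat

lemma binA_lt (c : ℕ → Bool) (n : ℕ) : binA c n < 2 ^ n := by
  induction n with
  | zero => simp [binA]
  | succ n ih =>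
    have : (c n).toNat ≤ 1 := Bool.toNat_le _
    simp only [binA, pow_succ]; omega

lemma dg_iff (c : ℕ → Bool) (n : ℕ) (x : ℝ) (hx : x ∈ Set.Ico (0:ℝ) 1) :
    (∀ k < n, dg x k = c k) ↔ ⌊x * 2 ^ n⌋.toNat = binA c n := by
  induction n with
  | zero =>
    have : ⌊x⌋ = 0 := Int.floor_eq_zero_iff.2 hx
    simp [binA, this]
  | succ n ih =>
    have key : (∀ k < n+1, dg x k = c k) ↔ ((∀ k < n, dg x k = c k) ∧ dg x n = c n) := by
      constructor
      · intro h; exact ⟨fun k hk => h k (by omega), h n (by omega)⟩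
      · rintro ⟨h1, h2⟩ k hk
        rcases Nat.lt_succ_iff_lt_or_eq.1 hk with h | h
        · exact h1 k h
        · rw [h]; exact h2
    rw [key, ih, floor_succ x n hx.1, binA]
    have h2 := digit_lt n x
    have h3 : dg x n = c n ↔ digit n x = (c n).toNat := by
      unfold dg
      cases c n <;> simp <;> omega
    rw [h3]
    have : (c n).toNat ≤ 1 := Bool.toNat_le _
    omega

lemma measurable_digit (n : ℕ) : Measurable (digit n) := by
  unfold digit
  have : Measurable (fun x : ℝ => ⌊x * 2 ^ (n+1)⌋) := Int.measurable_floor.comp (by fun_prop)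
  exact (measurable_from_top (f := fun z : ℤ => z.toNat % 2)).comp this

lemma measurable_dg : Measurable dg := by
  apply measurable_pi_lambda
  intro k
  exact (measurable_from_top (f := fun z : ℕ => decide (z = 1))).comp (measurable_digit k)

lemma uni_cyl (c : ℕ → Bool) (n : ℕ) :
    uni {x | ∀ k < n, dg x k = c k} = ENNReal.ofReal (1 / 2 ^ n) := by
  have hset : {x | ∀ k < n, dg x k = c k} ∩ Set.Ico (0:ℝ) 1 =
      Set.Ico ((binA c n : ℝ) / 2^n) (((binA c n : ℝ) + 1)/ 2^n) := by
    have hp : (0:ℝ) < 2 ^ n := by positivity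
    ext x
    constructor
    · rintro ⟨h, hx⟩
      have := (dg_iff c n x hx).1 h
      have h0 : (0:ℤ) ≤ ⌊x * 2 ^ n⌋ := Int.floor_nonneg.2 (by have := hx.1; positivity)
      have h1 : ⌊x * 2 ^ n⌋ = (binA c n : ℤ) := by omega
      rw [Int.floor_eq_iff] at h1
      push_cast at h1
      rw [Set.mem_Ico, div_le_iff₀ hp, lt_div_iff₀ hp]
      exact h1
    · intro h
      rw [Set.mem_Ico, div_le_iff₀ hp, lt_div_iff₀ hp] at h
      have hx : x ∈ Set.Ico (0:ℝ) 1 := by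
        constructor
        · by_contra h'
          push Not at h'
          have : x * 2^n < 0 := mul_neg_of_neg_of_pos h' hp
          have : (0:ℝ) ≤ binA c n := by positivity
          linarith [h.1]
        · have h1 : (binA c n : ℝ) + 1 ≤ 2 ^ n := by exact_mod_cast binA_lt c n
          by_contra h'
          push Not at h'
          nlinarith [h.2]
      refine ⟨?_, hx⟩
      have h1 : ⌊x * 2 ^ n⌋ = (binA c n : ℤ) := by
        rw [Int.floor_eq_iff]; push_cast; exact h
      refine (dg_iff c n x hx).2 (by omega)
  have hm : MeasurableSet {x | ∀ k < n, dg x k = c k} := by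
    have : {x | ∀ k < n, dg x k = c k} = dg ⁻¹' (Set.pi (Finset.range n) (fun k => {c k})) := by
      ext x; simp [Set.mem_pi]
    rw [this]
    apply measurable_dg
    exact MeasurableSet.pi (Finset.countable_toSet _) (fun _ _ => measurableSet_singleton _)
  rw [uni, Measure.restrict_apply hm, hset, Real.volume_Ico]
  congr 1
  field_simp
  ring

lemma coin_apply (b : Bool) : coin {b} = ENNReal.ofReal (1/2) := by
  have hm : Measurable (fun x => dg x 0) := (measurable_pi_apply 0).comp measurable_dg
  rw [coin, Measure.map_apply hm (measurableSet_singleton _)]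
  have := uni_cyl (fun _ => b) 1
  rw [pow_one] at this
  rw [← this]
  congr 1
  ext x; simp

instance coin_prob : IsProbabilityMeasure coin :=
  Measure.isProbabilityMeasure_map ((measurable_pi_apply 0).comp measurable_dg).aemeasurable

lemma map_dg : uni.map dg = Measure.infinitePi (fun _ : ℕ => coin) := by
  have : IsProbabilityMeasure (uni.map dg) :=
    Measure.isProbabilityMeasure_map measurable_dg.aemeasurable
  have hr : ∀ n : ℕ, (uni.map dg).map (Finset.range n).restrict =
      (Measure.infinitePi (fun _ : ℕ => coin)).map (Finset.range n).restrict := by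
    intro n
    apply Measure.ext_of_singleton
    intro a
    let c : ℕ → Bool := fun k => if h : k ∈ Finset.range n then a ⟨k, h⟩ else false
    have hpre : (Finset.range n).restrict (π := fun _ : ℕ => Bool) ⁻¹' {a} =
        Set.pi (Finset.range n : Set ℕ) (fun k => ({c k} : Set Bool)) := by
      ext f
      simp only [Set.mem_preimage, Set.mem_singleton_iff, Set.mem_pi, Finset.mem_coe]
      constructor
      · intro h k hk
        simp only [c, dif_pos hk, ← h]; rfl
      · intro h; ext ⟨k, hk⟩
        have := h k hk
        simp only [c, dif_pos hk] at this
        exact this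
    rw [Measure.map_apply (Finset.measurable_restrict _) (measurableSet_singleton _),
      Measure.map_apply (Finset.measurable_restrict _) (measurableSet_singleton _), hpre,
      Measure.infinitePi_pi _ (fun _ _ => measurableSet_singleton _)]
    rw [Measure.map_apply measurable_dg (MeasurableSet.pi (Finset.countable_toSet _)
      (fun _ _ => measurableSet_singleton _))]
    have := uni_cyl c n
    have h2 : dg ⁻¹' (Set.pi (Finset.range n : Set ℕ) (fun k => ({c k} : Set Bool))) =
      {x | ∀ k < n, dg x k = c k} := by ext x; simp [Set.mem_pi]
    rw [h2, this]
    simp only [coin_apply, Finset.prod_const, Finset.card_range]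
    rw [← ENNReal.ofReal_pow (by norm_num)]
    congr 1
    simp
  refine IsProjectiveLimit.unique (P := fun I : Finset ℕ => Measure.pi (fun i : I ↦ coin))
    ?_ (Measure.isProjectiveLimit_infinitePi _)
  intro I
  obtain ⟨n, hn⟩ : ∃ n, I ⊆ Finset.range n := Finset.exists_nat_subset_range I
  have e : I.restrict (π := fun _ : ℕ => Bool) = Finset.restrict₂ hn ∘ (Finset.range n).restrict := rfl
  rw [e, ← Measure.map_map (Finset.measurable_restrict₂ _) (Finset.measurable_restrict _), hr n,
    Measure.map_map (Finset.measurable_restrict₂ _) (Finset.measurable_restrict _), ← e]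
  exact Measure.infinitePi_map_restrict _

/-- binary expansion to real -/
noncomputable def binS (w : ℕ → Bool) : ℝ := ∑' k : ℕ, ((w k).toNat : ℝ) / 2 ^ (k + 1)

lemma binS_dg_tsum (x : ℝ) : binS (dg x) = ∑' k : ℕ, (digit k x : ℝ) / 2 ^ (k + 1) := by
  unfold binS
  congr 1; ext k
  have h2 := digit_lt k x
  have : ((dg x k).toNat) = digit k x := by
    unfold dg
    interval_cases h : digit k x <;> simp
  rw [this]

lemma binS_dg (x : ℝ) (hx : x ∈ Set.Ico (0:ℝ) 1) : binS (dg x) = x := by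
  rw [binS_dg_tsum]
  apply HasSum.tsum_eq
  rw [hasSum_iff_tendsto_nat_of_nonneg (fun i => by positivity)]
  have hs : ∀ n : ℕ, ∑ i ∈ Finset.range n, (digit i x : ℝ) / 2 ^ (i + 1) =
      (⌊x * 2 ^ n⌋.toNat : ℝ) / 2 ^ n := by
    intro n
    induction n with
    | zero =>
      have : ⌊x⌋ = 0 := Int.floor_eq_zero_iff.2 hx
      simp [this]
    | succ n ih =>
      rw [Finset.sum_range_succ, ih, floor_succ x n hx.1]
      push_cast
      field_simp
      ring
  simp_rw [hs]
  have ht := tendsto_nat_floor_mul_div_atTop hx.1 |>.comp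
    (tendsto_pow_atTop_atTop_of_one_lt (r := (2:ℝ)) (by norm_num))
  refine ht.congr fun n => ?_
  simp only [Function.comp, Int.floor_toNat]

lemma binS_cont : Continuous binS := by
  unfold binS
  apply continuous_tsum (u := fun k : ℕ => (1:ℝ) / 2 ^ (k+1))
  · intro i
    have : Continuous (fun b : Bool => ((b.toNat : ℕ) : ℝ) / 2 ^ (i+1)) := continuous_of_discreteTopology
    exact this.comp (continuous_apply i)
  · have := summable_geometric_two
    refine ((summable_nat_add_iff 1).2 this).congr ?_
    intro b; simp
  · intro n x
    have : ((x n).toNat : ℝ) ≤ 1 := by exact_mod_cast Bool.toNat_le _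
    rw [Real.norm_of_nonneg (by positivity)]
    gcongr

lemma measurable_binS : Measurable binS := binS_cont.measurable

lemma map_binS : (Measure.infinitePi (fun _ : ℕ => coin)).map binS = uni := by
  rw [← map_dg, Measure.map_map measurable_binS measurable_dg]
  have : binS ∘ dg =ᵐ[uni] id := by
    rw [uni, Filter.EventuallyEq, ae_restrict_iff' measurableSet_Ico]
    exact Eventually.of_forall (fun x hx => binS_dg x hx)
  rw [Measure.map_congr this, Measure.map_id]

lemma map_unif : uni.map (fun x (i : ℕ) => unif i x) = Measure.infinitePi (fun _ : ℕ => uni) := by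
  let e : ℕ × ℕ → ℕ := fun q => Nat.pair q.1 q.2
  have he : Function.Injective e := by
    rintro ⟨a, b⟩ ⟨c, d⟩ h
    have := Nat.pair_eq_pair.1 h
    simpa using this
  have h1 := Measure.map_infinitePi_infinitePi_of_inj (P := fun _ : ℕ => coin) he
  have h2 := Measure.infinitePi_map_curry (fun (_ _ : ℕ) => coin)
  have h3 := Measure.infinitePi_map_pi (μ := fun _ : ℕ => Measure.infinitePi (fun _ : ℕ => coin))
    (f := fun _ => binS) (fun _ => measurable_binS)
  simp only [map_binS] at h3
  rw [← h3, ← h2, ← h1, ← map_dg, Measure.map_map (by fun_prop) measurable_dg,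
    Measure.map_map (MeasurableEquiv.measurable _)
      ((by fun_prop : Measurable (fun (ω : ℕ → Bool) i => ω (e i))).comp measurable_dg),
    Measure.map_map (g := fun (x : ℕ → ℕ → Bool) (i : ℕ) => binS (x i))
      (measurable_pi_lambda _ fun i => measurable_binS.comp (measurable_pi_apply i))
      ((MeasurableEquiv.measurable _).comp
      ((by fun_prop : Measurable (fun (ω : ℕ → Bool) i => ω (e i))).comp measurable_dg))]
  congr 1
  ext x i
  simp only [Function.comp, MeasurableEquiv.curry, unif]
  unfold binS
  congr 1; ext k
  have h2 := digit_lt (Nat.pair i k) x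
  have : ((dg x (Nat.pair i k)).toNat) = digit (Nat.pair i k) x := by
    unfold dg
    interval_cases h : digit (Nat.pair i k) x <;> simp
  rw [← this]; rfl

lemma measurable_unif (i : ℕ) : Measurable (unif i) := by
  have : unif i = fun x => binS (fun k => dg x (Nat.pair i k)) := by
    ext x
    unfold binS unif
    congr 1; ext k
    have h2 := digit_lt (Nat.pair i k) x
    have : ((dg x (Nat.pair i k)).toNat) = digit (Nat.pair i k) x := by
      unfold dg
      interval_cases h : digit (Nat.pair i k) x <;> simp
    rw [← this]
  rw [this]
  refine measurable_binS.comp (measurable_pi_lambda _ fun k => ?_)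
  exact (measurable_pi_apply _).comp measurable_dg

/-- Bernoulli law -/
noncomputable def bern (p : ℝ) : Measure Bool := uni.map (fun u => if u < p then true else false)

lemma meas_thr (p : ℝ) : Measurable (fun u : ℝ => if u < p then true else false) :=
  Measurable.ite measurableSet_Iio measurable_const measurable_const

instance bern_prob (p : ℝ) : IsProbabilityMeasure (bern p) :=
  Measure.isProbabilityMeasure_map (meas_thr p).aemeasurable

/-- bonds with integer coordinates: `(x, s, y)` -/
abbrev B := ℤ × ℕ × ℤ
/-- configurations -/
abbrev Cf := B → Bool
/-- product Bernoulli measure -/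
noncomputable def mu (p : ℝ) : Measure Cf := Measure.infinitePi (fun _ : B => bern p)

instance mu_prob (p : ℝ) : IsProbabilityMeasure (mu p) := by unfold mu; infer_instance

/-- reading a configuration in integer coordinates -/
def pull (ω : Config 1) : Cf := fun b => ω ((fun _ => b.1, b.2.1), fun _ => b.2.2)

lemma measurable_config (p : ℝ) : Measurable (config 1 p) := by
  refine measurable_pi_lambda _ fun b => ?_
  exact (meas_thr p).comp (measurable_unif _)

lemma measurable_pull : Measurable pull := by unfold pull; fun_prop

lemma P_map (p : ℝ) : (P 1 p).map pull = mu p := by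
  have h1 := Measure.infinitePi_map_pi (μ := fun _ : ℕ => uni)
    (f := fun _ u => if u < p then true else false) (fun _ => meas_thr p)
  let e : B → ℕ := fun b => enc 1 ((fun _ => b.1, b.2.1), fun _ => b.2.2)
  have he : Function.Injective e := by
    rintro ⟨a, b, c⟩ ⟨a', b', c'⟩ h
    have := (exists_injective_nat (Bond 1)).choose_spec h
    simp only [Prod.mk.injEq, funext_iff] at this ⊢
    exact ⟨this.1.1 0, this.1.2, this.2 0⟩
  have h2 := Measure.map_infinitePi_infinitePi_of_inj (P := fun _ : ℕ => bern p) he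
  rw [mu, ← h2]
  have h3 : (Measure.infinitePi (fun _ : ℕ => bern p)) = _ := h1.symm
  have m1 : Measurable (fun (x : ℝ) (i : ℕ) => unif i x) :=
    measurable_pi_lambda _ fun i => measurable_unif i
  have m2 : Measurable (fun (x : ℕ → ℝ) (i : ℕ) => if x i < p then true else false) :=
    measurable_pi_lambda _ fun i => (meas_thr p).comp (measurable_pi_apply i)
  have m3 : Measurable (fun (ω : ℕ → Bool) (i : B) => ω (e i)) := by fun_prop
  rw [h3, ← map_unif, Measure.map_map m2 m1, Measure.map_map m3 (m2.comp m1), P,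
    Measure.map_map measurable_pull (measurable_config p)]
  rfl

lemma bern_true (p : ℝ) (hp : p ∈ Set.Icc (0:ℝ) 1) : bern p {true} = ENNReal.ofReal p := by
  rw [bern, Measure.map_apply (meas_thr p) (measurableSet_singleton _), uni,
    Measure.restrict_apply ((meas_thr p) (measurableSet_singleton _))]
  have : (fun u : ℝ => if u < p then true else false) ⁻¹' {true} ∩ Set.Ico 0 1 = Set.Ico 0 p := by
    ext u
    simp only [Set.mem_inter_iff, Set.mem_preimage, Set.mem_singleton_iff, Set.mem_Ico]
    have := hp.2
    constructor
    · rintro ⟨h, h2⟩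
      by_cases hu : u < p
      · exact ⟨h2.1, hu⟩
      · simp [hu] at h
    · rintro ⟨h1, h2⟩
      exact ⟨by simp [h2], h1, by linarith⟩
  rw [this, Real.volume_Ico]; simp

lemma bern_false (p : ℝ) (hp : p ∈ Set.Icc (0:ℝ) 1) : bern p {false} = ENNReal.ofReal (1 - p) := by
  have h : ({false} : Set Bool) = {true}ᶜ := by ext b; cases b <;> simp
  rw [h, prob_compl_eq_one_sub (measurableSet_singleton _), bern_true p hp,
    ENNReal.ofReal_sub _ hp.1, ENNReal.ofReal_one]

/-! ### Basic probability facts -/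

/-- probability of an event as a real number -/
noncomputable def pr (p : ℝ) (E : Set Cf) : ℝ := (mu p).real E

/-- `E` depends only on the bonds in `S` -/
def Dep (S : Set B) (E : Set Cf) : Prop :=
  ∀ ω ω' : Cf, (∀ b ∈ S, ω b = ω' b) → ω ∈ E → ω' ∈ E

/-- `E` depends on finitely many bonds -/
def FD (E : Set Cf) : Prop := ∃ S : Finset B, Dep S E

lemma Dep.mono {S T : Set B} {E : Set Cf} (h : Dep S E) (hST : S ⊆ T) : Dep T E :=
  fun ω ω' h1 h2 => h ω ω' (fun b hb => h1 b (hST hb)) h2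

lemma Dep.interSet {S T : Set B} {E : Set Cf} (h : Dep S E) (h' : Dep T E) : Dep (S ∩ T) E := by
  intro ω ω' h1 h2
  have a : (fun b => if b ∈ S then ω b else ω' b) ∈ E := h ω _ (fun b hb => by simp [hb]) h2
  refine h' _ ω' (fun b hb => ?_) a
  by_cases hS : b ∈ S
  · simp [hS, h1 b ⟨hS, hb⟩]
  · simp [hS]

lemma Dep.inter {S : Set B} {E E' : Set Cf} (h : Dep S E) (h' : Dep S E') : Dep S (E ∩ E') :=
  fun ω ω' h1 h2 => ⟨h ω ω' h1 h2.1, h' ω ω' h1 h2.2⟩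

lemma Dep.union {S : Set B} {E E' : Set Cf} (h : Dep S E) (h' : Dep S E') : Dep S (E ∪ E') :=
  fun ω ω' h1 h2 => h2.imp (h ω ω' h1) (h' ω ω' h1)

lemma Dep.compl {S : Set B} {E : Set Cf} (h : Dep S E) : Dep S Eᶜ :=
  fun ω ω' h1 h2 h3 => h2 (h ω' ω (fun b hb => (h1 b hb).symm) h3)

lemma FD.inter {E E' : Set Cf} (h : FD E) (h' : FD E') : FD (E ∩ E') := by
  obtain ⟨S, hS⟩ := h
  obtain ⟨T, hT⟩ := h'
  exact ⟨S ∪ T, (hS.mono (by simp)).inter (hT.mono (by simp))⟩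

lemma FD.union {E E' : Set Cf} (h : FD E) (h' : FD E') : FD (E ∪ E') := by
  obtain ⟨S, hS⟩ := h
  obtain ⟨T, hT⟩ := h'
  exact ⟨S ∪ T, (hS.mono (by simp)).union (hT.mono (by simp))⟩

lemma FD.compl {E : Set Cf} (h : FD E) : FD Eᶜ := by
  obtain ⟨S, hS⟩ := h
  exact ⟨S, hS.compl⟩

lemma FD.empty : FD ∅ := ⟨∅, fun _ _ _ h => h⟩
lemma FD.univ : FD Set.univ := ⟨∅, fun _ _ _ h => h⟩

/-- extension of a partial configuration -/
def extC (S : Finset B) (c : S → Bool) : Cf := fun b => if h : b ∈ S then c ⟨b, h⟩ else false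

lemma dep_cyl {S : Finset B} {E : Set Cf} (h : Dep S E) :
    E = S.restrict ⁻¹' {c : S → Bool | extC S c ∈ E} := by
  ext ω
  have : ∀ b ∈ (S : Set B), ω b = extC S (S.restrict ω) b := by
    intro b hb
    have hb' : b ∈ S := hb
    simp [extC, hb']
  exact ⟨fun hω => h _ _ this hω, fun hω => h _ _ (fun b hb => (this b hb).symm) hω⟩

lemma FD.meas {E : Set Cf} (h : FD E) : MeasurableSet E := by
  obtain ⟨S, hS⟩ := h
  rw [dep_cyl hS]
  exact (Finset.measurable_restrict S) (Set.toFinite _).measurableSet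

/-- weights -/
noncomputable def wt (p : ℝ) (b : Bool) : ℝ := if b then p else 1 - p

lemma wt_nonneg {p : ℝ} (hp : p ∈ Set.Icc (0:ℝ) 1) (b : Bool) : 0 ≤ wt p b := by
  unfold wt; have := hp.1; have := hp.2; split_ifs <;> linarith

lemma pr_formula {p : ℝ} (hp : p ∈ Set.Icc (0:ℝ) 1) {S : Finset B} {E : Set Cf} (h : Dep S E) :
    pr p E = ∑ c : S → Bool, (∏ b, wt p (c b)) * (if extC S c ∈ E then 1 else 0) := by
  have hb : ∀ b : Bool, bern p {b} = ENNReal.ofReal (wt p b) := by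
    intro b; cases b
    · simp [wt, bern_false p hp]
    · simp [wt, bern_true p hp]
  have h1 : mu p E = Measure.pi (fun _ : S => bern p) {c : S → Bool | extC S c ∈ E} := by
    conv_lhs => rw [dep_cyl h]
    rw [mu, ← Measure.infinitePi_map_restrict (I := S) (fun _ : B => bern p),
      Measure.map_apply (Finset.measurable_restrict S) (Set.toFinite _).measurableSet]
  rw [pr, Measure.real, h1]
  have h2 : {c : S → Bool | extC S c ∈ E} =
    ((Finset.univ.filter (fun c : S → Bool => extC S c ∈ E) : Finset (S → Bool)) : Set (S → Bool)) := by
    ext; simp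
  rw [h2, ← sum_measure_singleton, ENNReal.toReal_sum (fun _ _ => measure_ne_top _ _),
    Finset.sum_filter]
  apply Finset.sum_congr rfl
  intro c _
  split_ifs
  · rw [Measure.pi_singleton, ENNReal.toReal_prod, mul_one]
    apply Finset.prod_congr rfl
    intro b _
    rw [hb, ENNReal.toReal_ofReal (wt_nonneg hp _)]
  · simp

lemma pr_cont {E : Set Cf} (h : FD E) :
    ∃ f : ℝ → ℝ, Continuous f ∧ ∀ p ∈ Set.Icc (0:ℝ) 1, pr p E = f p := by
  obtain ⟨S, hS⟩ := h
  refine ⟨_, ?_, fun p hp => pr_formula hp hS⟩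
  refine continuous_finsetSum _ fun c _ => Continuous.mul ?_ continuous_const
  refine continuous_finsetProd _ fun b _ => ?_
  unfold wt
  split_ifs <;> fun_prop

lemma pr_nonneg (p : ℝ) (E : Set Cf) : 0 ≤ pr p E := measureReal_nonneg
lemma pr_le_one (p : ℝ) (E : Set Cf) : pr p E ≤ 1 := measureReal_le_one
lemma pr_mono (p : ℝ) {E E' : Set Cf} (h : E ⊆ E') : pr p E ≤ pr p E' := measureReal_mono h
lemma pr_union (p : ℝ) (E E' : Set Cf) : pr p (E ∪ E') ≤ pr p E + pr p E' := measureReal_union_le _ _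
lemma pr_univ (p : ℝ) : pr p Set.univ = 1 := by simp [pr]
lemma pr_empty (p : ℝ) : pr p ∅ = 0 := by simp [pr]
lemma pr_compl (p : ℝ) {E : Set Cf} (h : FD E) : pr p Eᶜ = 1 - pr p E := probReal_compl_eq_one_sub h.meas
lemma pr_diff (p : ℝ) {E E' : Set Cf} (h : FD E') (hs : E' ⊆ E) : pr p (E \ E') = pr p E - pr p E' :=
  measureReal_sdiff hs h.meas

lemma pr_biUnion {ι : Type*} (p : ℝ) (s : Finset ι) (f : ι → Set Cf) :
    pr p (⋃ i ∈ s, f i) ≤ ∑ i ∈ s, pr p (f i) := measureReal_biUnion_finset_le s f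

/-- Harris inequality -/
lemma harris {p : ℝ} (hp : p ∈ Set.Icc (0:ℝ) 1) {E E' : Set Cf} (h : FD E) (h' : FD E')
    (hi : IsUpperSet E) (hi' : IsUpperSet E') : pr p E * pr p E' ≤ pr p (E ∩ E') := by
  obtain ⟨S₁, hS₁⟩ := h
  obtain ⟨S₂, hS₂⟩ := h'
  let S := S₁ ∪ S₂
  have hS : Dep S E := hS₁.mono (by simp [S])
  have hS' : Dep S E' := hS₂.mono (by simp [S])
  rw [pr_formula hp hS, pr_formula hp hS', pr_formula hp (hS.inter hS')]
  have hmon : ∀ F : Set Cf, IsUpperSet F →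
      Monotone (fun c : S → Bool => if extC S c ∈ F then (1:ℝ) else 0) := by
    intro F hF c c' hcc
    have : extC S c ≤ extC S c' := by
      intro b
      unfold extC
      split_ifs
      · exact hcc _
      · exact le_rfl
    by_cases h1 : extC S c ∈ F
    · have h2 := hF this h1
      simp [h1, h2]
    · simp only [h1, if_false]; split_ifs <;> norm_num
  have hnn : ∀ F : Set Cf, (0 : (S → Bool) → ℝ) ≤ (fun c : S → Bool => if extC S c ∈ F then (1:ℝ) else 0) := by
    intro F c; simp only [Pi.zero_apply]; split_ifs <;> norm_num
  have key := fkg (μ := fun c : S → Bool => ∏ b, wt p (c b)) _ _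
    (fun c => Finset.prod_nonneg fun b _ => wt_nonneg hp _) (hnn E) (hnn E') (hmon E hi) (hmon E' hi')
    (by
      intro a b
      rw [← Finset.prod_mul_distrib, ← Finset.prod_mul_distrib]
      apply le_of_eq
      apply Finset.prod_congr rfl
      intro i _
      simp only [Pi.inf_apply, Pi.sup_apply]
      cases a i <;> cases b i <;> simp [mul_comm])
  have one : ∑ c : S → Bool, ∏ b, wt p (c b) = 1 := by
    have := pr_formula hp (S := S) (E := Set.univ) (fun _ _ _ _ => trivial)
    rw [pr_univ] at this
    simpa using this.symm
  rw [one, one_mul] at key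
  refine key.trans (le_of_eq ?_)
  apply Finset.sum_congr rfl
  intro c _
  congr 1
  by_cases h1 : extC S c ∈ E <;> by_cases h2 : extC S c ∈ E' <;> simp [h1, h2]

/-- independence -/
lemma indep (p : ℝ) {E E' : Set Cf} (h : FD E) (h' : FD E') {S T : Set B} (hS : Dep S E) (hT : Dep T E')
    (hST : Disjoint S T) : pr p (E ∩ E') = pr p E * pr p E' := by
  obtain ⟨S₁, hS₁⟩ := h
  obtain ⟨T₁, hT₁⟩ := h'
  have hS2 : Dep ((S₁.filter (· ∈ S) : Finset B) : Set B) E :=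
    (hS₁.interSet hS).mono (fun b hb => by simpa using hb)
  have hT2 : Dep ((T₁.filter (· ∈ T) : Finset B) : Set B) E' :=
    (hT₁.interSet hT).mono (fun b hb => by simpa using hb)
  have hd : Disjoint (S₁.filter (· ∈ S)) (T₁.filter (· ∈ T)) := by
    rw [Finset.disjoint_left]
    intro b hb hb'
    exact (Set.disjoint_left.1 hST) (Finset.mem_filter.1 hb).2 (Finset.mem_filter.1 hb').2
  have hI : ProbabilityTheory.iIndepFun (fun (i : B) (ω : Cf) => ω i) (mu p) :=
    ProbabilityTheory.iIndepFun_infinitePi (X := fun _ b => b) (fun _ => measurable_id)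
  have := (hI.indepFun_finset _ _ hd (fun i => measurable_pi_apply i)).measure_inter_preimage_eq_mul
    {c | extC _ c ∈ E} {c | extC _ c ∈ E'} (Set.toFinite _).measurableSet (Set.toFinite _).measurableSet
  have e1 := dep_cyl hS2
  have e2 := dep_cyl hT2
  change mu p (Finset.restrict _ ⁻¹' _ ∩ Finset.restrict _ ⁻¹' _) = mu p (Finset.restrict _ ⁻¹' _) *
    mu p (Finset.restrict _ ⁻¹' _) at this
  rw [← e1, ← e2] at this
  simp only [pr, Measure.real, this, ENNReal.toReal_mul]

/-- reindexing a configuration -/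
def reix (f : B → B) (E : Set Cf) : Set Cf := {ω | (fun b => ω (f b)) ∈ E}

lemma pr_reix (p : ℝ) {f : B → B} (hf : Function.Injective f) {E : Set Cf} (h : FD E) :
    pr p (reix f E) = pr p E := by
  have := Measure.map_infinitePi_infinitePi_of_inj (P := fun _ : B => bern p) hf
  have h2 : (mu p).map (fun ω b => ω (f b)) = mu p := this
  rw [pr, pr, Measure.real, Measure.real]
  conv_rhs => rw [← h2, Measure.map_apply (by fun_prop) h.meas]
  rfl

lemma Dep.reix {f : B → B} {S : Set B} {E : Set Cf} (h : Dep S E) : Dep (f '' S) (reix f E) :=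
  fun _ _ h1 h2 => h _ _ (fun b hb => h1 (f b) ⟨b, hb, rfl⟩) h2

lemma FD.reix {f : B → B} {E : Set Cf} (h : FD E) : FD (reix f E) := by
  obtain ⟨S, hS⟩ := h
  exact ⟨S.image f, by rw [Finset.coe_image]; exact hS.reix⟩

lemma up_reix {f : B → B} {E : Set Cf} (h : IsUpperSet E) : IsUpperSet (reix f E) :=
  fun _ _ h1 h2 => h (fun b => h1 (f b)) h2

lemma pr_bond {p : ℝ} (hp : p ∈ Set.Icc (0:ℝ) 1) (b : B) : pr p {ω | ω b = true} = p := by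
  have := Measure.infinitePi_pi (μ := fun _ : B => bern p) (s := {b}) (t := fun _ => {true})
    (fun _ _ => measurableSet_singleton _)
  have h2 : {ω : Cf | ω b = true} = Set.pi (({b} : Finset B) : Set B) (fun _ => ({true} : Set Bool)) := by
    ext; simp
  rw [pr, Measure.real, h2, mu, this]
  simp [bern_true p hp, hp.1]

/-! ### Paths -/

/-- nearest neighbour path on `[s,t]` -/
def NN (s t : ℕ) (v : ℕ → ℤ) : Prop := ∀ j, s ≤ j → j < t → v (j+1) = v j + 1 ∨ v (j+1) = v j - 1

/-- all bonds of the path are open -/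
def Op (ω : Cf) (s t : ℕ) (v : ℕ → ℤ) : Prop := ∀ j, s ≤ j → j < t → ω (v j, j, v (j+1)) = true

/-- existence of an open path with a given property -/
def Pe (s t : ℕ) (φ : (ℕ → ℤ) → Prop) : Set Cf := {ω | ∃ v, φ v ∧ NN s t v ∧ Op ω s t v}

lemma Pe_mono {s t : ℕ} {φ ψ : (ℕ → ℤ) → Prop} (h : ∀ v, NN s t v → φ v → ψ v) : Pe s t φ ⊆ Pe s t ψ := by
  rintro ω ⟨v, h1, h2, h3⟩
  exact ⟨v, h v h2 h1, h2, h3⟩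

lemma Pe_up (s t : ℕ) (φ : (ℕ → ℤ) → Prop) : IsUpperSet (Pe s t φ) := by
  rintro ω ω' h ⟨v, h1, h2, h3⟩
  refine ⟨v, h1, h2, fun j hj hj' => ?_⟩
  have := h (v j, j, v (j+1))
  rw [h3 j hj hj'] at this
  exact top_le_iff.1 this

lemma NN.sub {s t s' t' : ℕ} {v : ℕ → ℤ} (h : NN s t v) (h1 : s ≤ s') (h2 : t' ≤ t) : NN s' t' v :=
  fun j a b => h j (by omega) (by omega)

lemma Op.sub {ω : Cf} {s t s' t' : ℕ} {v : ℕ → ℤ} (h : Op ω s t v) (h1 : s ≤ s') (h2 : t' ≤ t) :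
    Op ω s' t' v :=
  fun j a b => h j (by omega) (by omega)

lemma NN.bd {s t : ℕ} {v : ℕ → ℤ} (h : NN s t v) {a b : ℕ} (h1 : s ≤ a) (h2 : a ≤ b) (h3 : b ≤ t) :
    |v b - v a| ≤ (b:ℤ) - a := by
  induction b, h2 using Nat.le_induction with
  | base => simp
  | succ n hn ih =>
    have := ih (by omega)
    have h4 := h n (by omega) (by omega)
    rw [abs_le] at this ⊢
    push_cast
    omega

lemma NN.par {s t : ℕ} {v : ℕ → ℤ} (h : NN s t v) {a b : ℕ} (h1 : s ≤ a) (h2 : a ≤ b) (h3 : b ≤ t) :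
    (Even (v b + b) ↔ Even (v a + a)) := by
  induction b, h2 using Nat.le_induction with
  | base => simp
  | succ n hn ih =>
    have := ih (by omega)
    have h4 := h n (by omega) (by omega)
    rw [← this]
    rw [Int.even_iff, Int.even_iff]
    push_cast
    omega

lemma Dep_Pe {s t : ℕ} {φ : (ℕ → ℤ) → Prop} {S : Set B}
    (h : ∀ v, φ v → NN s t v → ∀ j, s ≤ j → j < t → (v j, j, v (j+1)) ∈ S) : Dep S (Pe s t φ) := by
  rintro ω ω' h1 ⟨v, h2, h3, h4⟩
  exact ⟨v, h2, h3, fun j hj hj' => by rw [← h1 _ (h v h2 h3 j hj hj')]; exact h4 j hj hj'⟩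

lemma FD_Pe {s t : ℕ} {φ : (ℕ → ℤ) → Prop} (N : ℤ)
    (h : ∀ v, φ v → NN s t v → |v s| ≤ N) : FD (Pe s t φ) := by
  refine ⟨(Finset.Icc (-(N+t)) (N+t)) ×ˢ (Finset.range t) ×ˢ (Finset.Icc (-(N+t)) (N+t)), ?_⟩
  apply Dep_Pe
  intro v hv hn j hj hj'
  have h1 := h v hv hn
  have h2 := hn.bd le_rfl hj hj'.le
  have h3 := hn.bd le_rfl (by omega : s ≤ j+1) hj'
  rw [abs_le] at h1 h2 h3
  push_cast at h3
  simp only [Finset.coe_product, Set.mem_prod, Finset.mem_coe, Finset.mem_Icc, Finset.mem_range]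
  refine ⟨⟨?_, ?_⟩, hj', ?_, ?_⟩ <;> omega

lemma Dep_time {s t : ℕ} (φ : (ℕ → ℤ) → Prop) : Dep {b : B | s ≤ b.2.1 ∧ b.2.1 < t} (Pe s t φ) :=
  Dep_Pe (fun _ _ _ _ hj hj' => ⟨hj, hj'⟩)

/-- shift of bonds -/
def sh (c : ℤ) (s : ℕ) (b : B) : B := (b.1 + c, b.2.1 + s, b.2.2 + c)
/-- mirror image -/
def mir (b : B) : B := (-b.1, b.2.1, -b.2.2)
/-- time reversal -/
def rev (n : ℕ) (b : B) : B := if b.2.1 < n then (b.2.2, n - 1 - b.2.1, b.1) else b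

lemma sh_inj (c : ℤ) (s : ℕ) : Function.Injective (sh c s) := by
  rintro ⟨a, b, d⟩ ⟨a', b', d'⟩ h
  simpa [sh] using h

lemma mir_inj : Function.Injective mir := by
  rintro ⟨a, b, d⟩ ⟨a', b', d'⟩ h
  simpa [mir] using h

lemma rev_inj (n : ℕ) : Function.Injective (rev n) := by
  have : Function.Involutive (rev n) := by
    rintro ⟨a, b, d⟩
    by_cases h : b < n
    · have h2 : n - 1 - b < n := by omega
      have h3 : n - 1 - (n - 1 - b) = b := by omega
      simp [rev, h, h2, h3]
    · simp [rev, h]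
  exact this.injective

lemma reix_sh (c : ℤ) (r s t : ℕ) (φ : (ℕ → ℤ) → Prop) :
    reix (sh c r) (Pe s t φ) = Pe (s + r) (t + r) (fun v => φ (fun j => v (j + r) - c)) := by
  ext ω
  constructor
  · rintro ⟨v, h1, h2, h3⟩
    refine ⟨fun j => v (j - r) + c, by simpa using h1, fun j hj hj' => ?_, fun j hj hj' => ?_⟩
    · have := h2 (j - r) (by omega) (by omega)
      have e : j + 1 - r = j - r + 1 := by omega
      simp only [e]; omega
    · have := h3 (j - r) (by omega) (by omega)
      have e : j + 1 - r = j - r + 1 := by omega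
      have e2 : j - r + r = j := by omega
      simpa only [e, sh, e2] using this
  · rintro ⟨v, h1, h2, h3⟩
    refine ⟨fun j => v (j + r) - c, h1, fun j hj hj' => ?_, fun j hj hj' => ?_⟩
    · have := h2 (j + r) (by omega) (by omega)
      have e : j + 1 + r = j + r + 1 := by omega
      simp only [e]; omega
    · have := h3 (j + r) (by omega) (by omega)
      have e : j + 1 + r = j + r + 1 := by omega
      simpa only [e, sh, sub_add_cancel] using this

lemma reix_mir (s t : ℕ) (φ : (ℕ → ℤ) → Prop) :
    reix mir (Pe s t φ) = Pe s t (fun v => φ (fun j => - v j)) := by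
  ext ω
  constructor
  · rintro ⟨v, h1, h2, h3⟩
    refine ⟨fun j => - v j, by simpa using h1, fun j hj hj' => ?_, fun j hj hj' => ?_⟩
    · have := h2 j hj hj'
      dsimp only
      omega
    · exact h3 j hj hj'
  · rintro ⟨v, h1, h2, h3⟩
    refine ⟨fun j => - v j, h1, fun j hj hj' => ?_, fun j hj hj' => ?_⟩
    · have := h2 j hj hj'
      dsimp only
      omega
    · have := h3 j hj hj'
      simpa only [mir, neg_neg] using this

lemma reix_rev (n : ℕ) (A : ℤ → ℤ → Prop) :
    reix (rev n) (Pe 0 n (fun v => A (v 0) (v n))) = Pe 0 n (fun v => A (v n) (v 0)) := by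
  ext ω
  constructor
  · rintro ⟨v, h1, h2, h3⟩
    refine ⟨fun j => v (n - j), by simpa using h1, fun j hj hj' => ?_, fun j hj hj' => ?_⟩
    · have := h2 (n - (j+1)) (by omega) (by omega)
      have e : n - (j + 1) + 1 = n - j := by omega
      rw [e] at this
      dsimp only
      omega
    · have := h3 (n - (j+1)) (by omega) (by omega)
      have e : n - (j + 1) + 1 = n - j := by omega
      have e2 : n - 1 - (n - (j+1)) = j := by omega
      have e3 : n - (j+1) < n := by omega
      simpa only [e, rev, e2, e3, if_true] using this
  · rintro ⟨v, h1, h2, h3⟩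
    refine ⟨fun j => v (n - j), by simpa using h1, fun j hj hj' => ?_, fun j hj hj' => ?_⟩
    · have := h2 (n - (j+1)) (by omega) (by omega)
      have e : n - (j + 1) + 1 = n - j := by omega
      rw [e] at this
      dsimp only
      omega
    · have := h3 (n - (j+1)) (by omega) (by omega)
      have e : n - (j + 1) + 1 = n - j := by omega
      have e2 : n - 1 - j = n - (j + 1) := by omega
      simpa only [e, rev, e2, hj', if_true] using this

lemma pr_sh (p : ℝ) (c : ℤ) (r s t : ℕ) (φ : (ℕ → ℤ) → Prop) (h : FD (Pe s t φ)) :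
    pr p (Pe (s + r) (t + r) (fun v => φ (fun j => v (j + r) - c))) = pr p (Pe s t φ) := by
  rw [← reix_sh, pr_reix p (sh_inj c r) h]

lemma pr_mir (p : ℝ) (s t : ℕ) (φ : (ℕ → ℤ) → Prop) (h : FD (Pe s t φ)) :
    pr p (Pe s t (fun v => φ (fun j => - v j))) = pr p (Pe s t φ) := by
  rw [← reix_mir, pr_reix p mir_inj h]

lemma pr_rev (p : ℝ) (n : ℕ) (A : ℤ → ℤ → Prop) (h : FD (Pe 0 n (fun v => A (v 0) (v n)))) :
    pr p (Pe 0 n (fun v => A (v n) (v 0))) = pr p (Pe 0 n (fun v => A (v 0) (v n))) := by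
  rw [← reix_rev, pr_reix p (rev_inj n) h]

/-! ### Deterministic lemmas -/

lemma meet {a b : ℕ} {v w : ℕ → ℤ} (hv : NN a b v) (hw : NN a b w) (hab : a ≤ b)
    (hpar : Even (v a + w a)) (h1 : v a ≤ w a) (h2 : w b ≤ v b) : ∃ c, a ≤ c ∧ c ≤ b ∧ v c = w c := by
  have hP : ∃ c, a ≤ c ∧ w c ≤ v c := ⟨b, hab, h2⟩
  let c := Nat.find hP
  have hc : a ≤ c ∧ w c ≤ v c := Nat.find_spec hP
  have hcb : c ≤ b := Nat.find_min' hP ⟨hab, h2⟩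
  refine ⟨c, hc.1, hcb, ?_⟩
  rcases Nat.eq_or_lt_of_le hc.1 with h | h
  · rw [← h] at hc ⊢; omega
  · have h3 := Nat.find_min hP (m := c - 1) (by change c - 1 < c; omega)
    push Not at h3
    have h4 := h3 (by omega)
    have p1 := hv.par le_rfl (by omega : a ≤ c - 1) (by omega)
    have p2 := hw.par le_rfl (by omega : a ≤ c - 1) (by omega)
    have s1 := hv (c-1) (by omega) (by omega)
    have s2 := hw (c-1) (by omega) (by omega)
    have e : c - 1 + 1 = c := by omega
    rw [e] at s1 s2
    rw [Int.even_iff] at hpar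
    rw [Int.even_iff, Int.even_iff] at p1 p2
    omega

/-- splicing -/
def spl (c : ℕ) (v w : ℕ → ℤ) : ℕ → ℤ := fun j => if j ≤ c then v j else w j

lemma spl_le {c j : ℕ} {v w : ℕ → ℤ} (h : j ≤ c) : spl c v w j = v j := if_pos h
lemma spl_ge {c j : ℕ} {v w : ℕ → ℤ} (hc : v c = w c) (h : c ≤ j) : spl c v w j = w j := by
  unfold spl
  split_ifs with h1
  · have : j = c := le_antisymm h1 h
    rw [this, hc]
  · rfl

lemma spl_NN {a b c : ℕ} {v w : ℕ → ℤ} (hv : NN a c v) (hw : NN c b w) (hc : v c = w c) :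
    NN a b (spl c v w) := by
  intro j hj hj'
  rcases Nat.lt_or_ge j c with h | h
  · rw [spl_le (by omega), spl_le (by omega)]
    exact hv j hj h
  · rw [spl_ge hc (by omega), spl_ge hc h]
    exact hw j h hj'

lemma spl_Op {ω : Cf} {a b c : ℕ} {v w : ℕ → ℤ} (hv : Op ω a c v) (hw : Op ω c b w) (hc : v c = w c) :
    Op ω a b (spl c v w) := by
  intro j hj hj'
  rcases Nat.lt_or_ge j c with h | h
  · rw [spl_le (by omega), spl_le (by omega)]
    exact hv j hj h
  · rw [spl_ge (j := j+1) hc (by omega), spl_ge hc h]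
    exact hw j h hj'

/-- first hitting of a level from below -/
lemma hit_first {a b : ℕ} {v : ℕ → ℤ} (hv : NN a b v) (hab : a ≤ b) {z : ℤ} (h1 : v a ≤ z) (h2 : z ≤ v b) :
    ∃ c, a ≤ c ∧ c ≤ b ∧ v c = z ∧ ∀ j, a ≤ j → j ≤ c → v j ≤ z := by
  have hP : ∃ c, a ≤ c ∧ z ≤ v c := ⟨b, hab, h2⟩
  let c := Nat.find hP
  have hc : a ≤ c ∧ z ≤ v c := Nat.find_spec hP
  have hcb : c ≤ b := Nat.find_min' hP ⟨hab, h2⟩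
  have hlt : ∀ j, a ≤ j → j < c → v j < z := by
    intro j hj hj'
    have := Nat.find_min hP hj'
    push Not at this
    exact this hj
  have hz : v c = z := by
    rcases Nat.eq_or_lt_of_le hc.1 with h | h
    · rw [← h] at hc ⊢; omega
    · have h4 := hlt (c-1) (by omega) (by omega)
      have s1 := hv (c-1) (by omega) (by omega)
      have e : c - 1 + 1 = c := by omega
      rw [e] at s1
      omega
  refine ⟨c, hc.1, hcb, hz, fun j hj hj' => ?_⟩
  rcases Nat.eq_or_lt_of_le hj' with h | h
  · rw [h, hz]
  · exact (hlt j hj h).le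

/-- last hitting of a level -/
lemma hit_last {a b : ℕ} {v : ℕ → ℤ} (hv : NN a b v) (hab : a ≤ b) {z : ℤ} (h1 : v a ≤ z) (h2 : z ≤ v b) :
    ∃ c, a ≤ c ∧ c ≤ b ∧ v c = z ∧ ∀ j, c ≤ j → j ≤ b → z ≤ v j := by
  induction b, hab using Nat.le_induction with
  | base => exact ⟨a, le_rfl, le_rfl, by omega, fun j hj hj' => by
      have : j = a := by omega
      rw [this]; exact h2⟩
  | succ b hab ih =>
    by_cases h : v (b+1) = z
    · exact ⟨b+1, by omega, le_rfl, h, fun j hj hj' => by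
        have : j = b+1 := by omega
        rw [this]; exact h2⟩
    · have s1 := hv b hab (by omega)
      obtain ⟨c, h3, h4, h5, h6⟩ := ih (hv.sub le_rfl (by omega)) (by omega)
      refine ⟨c, h3, by omega, h5, fun j hj hj' => ?_⟩
      rcases Nat.eq_or_lt_of_le hj' with h7 | h7
      · rw [h7]; omega
      · exact h6 j hj (by omega)

lemma cross {a b : ℕ} {v : ℕ → ℤ} (hv : NN a b v) (hab : a ≤ b) {c d : ℤ} (hcd : c ≤ d)
    (h1 : v a ≤ c) (h2 : d ≤ v b) :
    ∃ s t, a ≤ s ∧ s ≤ t ∧ t ≤ b ∧ v s = c ∧ v t = d ∧ ∀ j, s ≤ j → j ≤ t → c ≤ v j ∧ v j ≤ d := by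
  obtain ⟨t, t1, t2, t3, t4⟩ := hit_first hv hab (h1.trans hcd) h2
  obtain ⟨s, s1, s2, s3, s4⟩ := hit_last (hv.sub le_rfl t2) t1 h1 (by omega)
  exact ⟨s, t, s1, s2, t2, s3, t3, fun j hj hj' => ⟨s4 j hj hj', t4 j (by omega) hj'⟩⟩

/-! ### The basic events -/

/-- path from the half line left of `x` to the half line right of `z` -/
def G (s t : ℕ) (x z : ℤ) : Set Cf := Pe s t (fun v => v s ≤ x ∧ Even (v s + s) ∧ z ≤ v t)
/-- mirror image of `G` -/
def Gm (s t : ℕ) (x z : ℤ) : Set Cf := Pe s t (fun v => x ≤ v s ∧ Even (v s + s) ∧ v t ≤ z)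
/-- the function `F` -/
noncomputable def F (p : ℝ) (n : ℕ) (y : ℤ) : ℝ := pr p (G 0 n 0 y)

lemma FD_G {s t : ℕ} (h : s ≤ t) (x z : ℤ) : FD (G s t x z) := by
  apply FD_Pe (|x| + |z| + t)
  rintro v ⟨h1, h2, h3⟩ hn
  have := hn.bd le_rfl h le_rfl
  have := abs_le.1 this
  have := neg_abs_le z
  have := le_abs_self x
  have := abs_nonneg x
  have := abs_nonneg z
  rw [abs_le]; omega

lemma FD_Gm {s t : ℕ} (h : s ≤ t) (x z : ℤ) : FD (Gm s t x z) := by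
  apply FD_Pe (|x| + |z| + t)
  rintro v ⟨h1, h2, h3⟩ hn
  have := hn.bd le_rfl h le_rfl
  have := abs_le.1 this
  have := neg_abs_le x
  have := le_abs_self z
  have := abs_nonneg x
  have := abs_nonneg z
  rw [abs_le]; omega

lemma G_up (s t : ℕ) (x z : ℤ) : IsUpperSet (G s t x z) := Pe_up _ _ _
lemma Gm_up (s t : ℕ) (x z : ℤ) : IsUpperSet (Gm s t x z) := Pe_up _ _ _

lemma Gm_eq (p : ℝ) {s t : ℕ} (h : s ≤ t) (x z : ℤ) : pr p (Gm s t x z) = pr p (G s t (-x) (-z)) := by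
  have := pr_mir p s t _ (FD_G h (-x) (-z))
  rw [G, ← this, Gm]
  congr 2
  ext v
  beta_reduce
  have : Even (-v s + s) ↔ Even (v s + s) := by rw [Int.even_iff, Int.even_iff]; omega
  rw [this]
  constructor <;> rintro ⟨h1, h2, h3⟩ <;> exact ⟨by omega, h2, by omega⟩

lemma G_eq (p : ℝ) {s t : ℕ} (h : s ≤ t) {x : ℤ} (z : ℤ) (hx : Even (x + s)) :
    pr p (G s t x z) = F p (t - s) (z - x) := by
  have := pr_sh p x s 0 (t-s) _ (FD_G (Nat.zero_le (t-s)) 0 (z - x))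
  rw [F, G, G, ← this, Nat.zero_add, Nat.sub_add_cancel h]
  congr 2
  ext v
  beta_reduce
  rw [Nat.zero_add, Nat.sub_add_cancel h]
  have : Even (v s - x + (0:ℕ)) ↔ Even (v s + s) := by
    rw [Int.even_iff] at hx ⊢; rw [Int.even_iff]; push_cast; omega
  rw [this]
  constructor <;> rintro ⟨h1, h2, h3⟩ <;> exact ⟨by omega, h2, by omega⟩

lemma G_mono {s t : ℕ} {x z x' z' : ℤ} (h1 : x ≤ x') (h2 : z' ≤ z) : G s t x z ⊆ G s t x' z' :=
  Pe_mono (fun v _ ⟨a, b, c⟩ => ⟨by omega, b, by omega⟩)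

lemma F_anti (p : ℝ) (n : ℕ) {y y' : ℤ} (h : y ≤ y') : F p n y' ≤ F p n y :=
  pr_mono p (G_mono le_rfl h)

lemma G_le (p : ℝ) {s t : ℕ} (h : s ≤ t) (x z : ℤ) : pr p (G s t x z) ≤ F p (t - s) (z - x) := by
  by_cases hx : Even (x + s)
  · exact (G_eq p h z hx).le
  · have hx' : Even (x - 1 + s) := by rw [Int.even_iff] at hx ⊢; omega
    have h2 : G s t x z ⊆ G s t (x-1) (z-1) :=
      Pe_mono (fun v _ ⟨a, b, c⟩ => ⟨by rw [Int.even_iff] at hx b; omega, b, by omega⟩)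
    refine (pr_mono p h2).trans ?_
    rw [G_eq p h (z-1) hx']
    have : z - 1 - (x - 1) = z - x := by ring
    rw [this]

lemma Gm_le (p : ℝ) {s t : ℕ} (h : s ≤ t) (x z : ℤ) : pr p (Gm s t x z) ≤ F p (t - s) (x - z) := by
  rw [Gm_eq p h]
  have := G_le p h (-x) (-z)
  rwa [show -z - -x = x - z by ring] at this

lemma Gm_eq' (p : ℝ) {s t : ℕ} (h : s ≤ t) {x : ℤ} (z : ℤ) (hx : Even (x + s)) :
    pr p (Gm s t x z) = F p (t - s) (x - z) := by
  rw [Gm_eq p h, G_eq p h]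
  · rw [show -z - -x = x - z by ring]
  · rw [Int.even_iff] at hx ⊢; omega

lemma F_nonneg (p : ℝ) (n : ℕ) (y : ℤ) : 0 ≤ F p n y := pr_nonneg _ _
lemma F_le_one (p : ℝ) (n : ℕ) (y : ℤ) : F p n y ≤ 1 := pr_le_one _ _

lemma F_zero_of_gt (p : ℝ) {n : ℕ} {y : ℤ} (h : (n:ℤ) < y) : F p n y = 0 := by
  have : G 0 n 0 y = ∅ := by
    ext ω
    simp only [Set.mem_empty_iff_false, iff_false]
    rintro ⟨v, ⟨h1, h2, h3⟩, hn, _⟩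
    have := abs_le.1 (hn.bd le_rfl (Nat.zero_le n) le_rfl)
    push_cast at this
    omega
  rw [F, this, pr_empty]

lemma F_zero_zero (p : ℝ) : F p 0 0 = 1 := by
  have : G 0 0 0 0 = Set.univ := by
    ext ω
    simp only [Set.mem_univ, iff_true]
    exact ⟨fun _ => 0, ⟨le_rfl, by simp, le_rfl⟩, fun j _ h => by omega, fun j _ h => by omega⟩
  rw [F, this, pr_univ]

lemma FD_bond (b : B) : FD {ω : Cf | ω b = true} := by
  refine ⟨{b}, fun ω ω' h h' => ?_⟩
  have := h b (by simp)
  simp only [Set.mem_ofPred_eq] at h' ⊢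
  rw [← this, h']

lemma up_bond (b : B) : IsUpperSet {ω : Cf | ω b = true} := by
  intro ω ω' h h'
  have := h b
  simp only [Set.mem_ofPred_eq] at h' ⊢
  rw [h'] at this
  exact top_le_iff.1 this

lemma FD_Op (n : ℕ) (v : ℕ → ℤ) : FD {ω : Cf | Op ω 0 n v} := by
  refine ⟨(Finset.range n).image (fun j => (v j, j, v (j+1))), fun ω ω' h h' j hj hj' => ?_⟩
  have := h (v j, j, v (j+1)) (by
    simp only [Finset.coe_image, Set.mem_image, Finset.mem_coe, Finset.mem_range]
    exact ⟨j, hj', rfl⟩)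
  rw [← this, h' j hj hj']

lemma up_Op (n : ℕ) (v : ℕ → ℤ) : IsUpperSet {ω : Cf | Op ω 0 n v} := by
  intro ω ω' h h' j hj hj'
  exact up_bond _ h (h' j hj hj')

lemma pr_Op {p : ℝ} (hp : p ∈ Set.Icc (0:ℝ) 1) (n : ℕ) (v : ℕ → ℤ) :
    p ^ n ≤ pr p {ω : Cf | Op ω 0 n v} := by
  induction n with
  | zero =>
    have : {ω : Cf | Op ω 0 0 v} = Set.univ := by
      ext ω; simp only [Set.mem_ofPred_eq, Set.mem_univ, iff_true]; intro j _ h; omega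
    rw [this, pr_univ]; simp
  | succ n ih =>
    have h1 := harris hp (FD_Op n v) (FD_bond (v n, n, v (n+1))) (up_Op n v) (up_bond _)
    rw [pr_bond hp] at h1
    have h2 : {ω : Cf | Op ω 0 n v} ∩ {ω : Cf | ω (v n, n, v (n+1)) = true} ⊆ {ω : Cf | Op ω 0 (n+1) v} := by
      rintro ω ⟨a, b⟩ j hj hj'
      rcases Nat.lt_succ_iff_lt_or_eq.1 hj' with h | h
      · exact a j hj h
      · rw [h]; exact b
    have h3 := pr_mono p h2
    have := hp.1
    calc p ^ (n+1) = p ^ n * p := pow_succ _ _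
      _ ≤ _ * p := by gcongr
      _ ≤ _ := h1.trans h3

lemma F_diag {p : ℝ} (hp : p ∈ Set.Icc (0:ℝ) 1) (n : ℕ) : p ^ n ≤ F p n n := by
  refine (pr_Op hp n (fun j => (j:ℤ))).trans (pr_mono p ?_)
  intro ω h
  exact ⟨fun j => (j:ℤ), ⟨by simp, by simp, le_rfl⟩, fun j _ _ => by left; push_cast; ring, h⟩

/-! ### Horizontal crossings -/

/-- paths crossing from `0` to `w` inside `[0,w]` between times `s` and `t` -/
def Hpath (w : ℕ) (s t : ℕ) : Set Cf :=
  Pe s t (fun v => v s = 0 ∧ v t = w ∧ Even s ∧ ∀ j, s ≤ j → j ≤ t → 0 ≤ v j ∧ v j ≤ w)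

/-- left-right crossing of `[0,w] × [0,h]` -/
def Hev (w h : ℕ) : Set Cf := {ω | ∃ s t, s ≤ t ∧ t ≤ h ∧ ω ∈ Hpath w s t}

/-- its probability -/
noncomputable def Hr (p : ℝ) (w h : ℕ) : ℝ := pr p (Hev w h)

lemma Hev_up (w h : ℕ) : IsUpperSet (Hev w h) := by
  rintro ω ω' h1 ⟨s, t, h2, h3, h4⟩
  exact ⟨s, t, h2, h3, Pe_up _ _ _ h1 h4⟩

lemma Hev_dep (w h : ℕ) : Dep {b : B | 0 ≤ b.1 ∧ b.1 ≤ w ∧ 0 ≤ b.2.2 ∧ b.2.2 ≤ w ∧ b.1 ≠ b.2.2 ∧ b.2.1 < h}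
    (Hev w h) := by
  rintro ω ω' h1 ⟨s, t, h2, h3, h4⟩
  refine ⟨s, t, h2, h3, ?_⟩
  refine Dep_Pe ?_ ω ω' h1 h4
  rintro v ⟨a1, a2, a3, a4⟩ hn j hj hj'
  have b1 := a4 j hj hj'.le
  have b2 := a4 (j+1) (by omega) hj'
  have b3 := hn j hj hj'
  exact ⟨b1.1, b1.2, b2.1, b2.2, by simp only; omega, by simp only; omega⟩

lemma Hev_FD (w h : ℕ) : FD (Hev w h) := by
  refine ⟨(Finset.Icc (0:ℤ) w) ×ˢ (Finset.range h) ×ˢ (Finset.Icc (0:ℤ) w), (Hev_dep w h).mono ?_⟩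
  rintro ⟨x, s, y⟩ ⟨h1, h2, h3, h4, h5, h6⟩
  simp only [Finset.coe_product, Set.mem_prod, Finset.mem_coe, Finset.mem_Icc, Finset.mem_range]
  exact ⟨⟨h1, h2⟩, h6, h3, h4⟩

lemma cross_Hev {ω : Cf} {a b : ℕ} {v : ℕ → ℤ} (hn : NN a b v) (ho : Op ω a b v) (hab : a ≤ b)
    (hpar : Even (v a + a)) {c : ℤ} {w r h : ℕ} (h1 : v a ≤ c) (h2 : c + w ≤ v b) (hc : Even (c + r))
    (hr : r ≤ a) (hb : b ≤ r + h) : ω ∈ reix (sh c r) (Hev w h) := by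
  obtain ⟨s, t, h3, h4, h5, h6, h7, h8⟩ := cross hn hab (by omega : c ≤ c + w) h1 h2
  refine ⟨s - r, t - r, by omega, by omega, ?_⟩
  change ω ∈ reix (sh c r) (Hpath w (s-r) (t-r))
  rw [Hpath, reix_sh]
  have e1 : s - r + r = s := by omega
  have e2 : t - r + r = t := by omega
  refine ⟨v, ⟨?_, ?_, ?_, ?_⟩, ?_, ?_⟩
  · beta_reduce; rw [e1]; omega
  · beta_reduce; rw [e2]; omega
  · have := (hn.par le_rfl h3 (by omega : s ≤ b)).2 hpar
    rw [h6] at this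
    rw [Int.even_iff] at this hc
    rw [Nat.even_iff]; omega
  · intro j hj hj'
    have := h8 (j + r) (by omega) (by omega)
    beta_reduce
    omega
  · rw [e1, e2]; exact hn.sub h3 h5
  · rw [e1, e2]; exact ho.sub h3 h5

lemma Hr_zero (p : ℝ) (h : ℕ) : Hr p 0 h = 1 := by
  have : Hev 0 h = Set.univ := by
    ext ω
    simp only [Set.mem_univ, iff_true]
    exact ⟨0, 0, le_rfl, by omega, fun _ => 0, ⟨rfl, by simp, by simp, fun j _ _ => by simp⟩,
      fun j _ h => by omega, fun j _ h => by omega⟩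
  rw [Hr, this, pr_univ]

lemma Hr_one (p : ℝ) {w h : ℕ} (hw : h < w) : Hr p w h = 0 := by
  have : Hev w h = ∅ := by
    ext ω
    simp only [Set.mem_empty_iff_false, iff_false]
    rintro ⟨s, t, h1, h2, v, ⟨h3, h4, _⟩, hn, _⟩
    have := abs_le.1 (hn.bd le_rfl h1 le_rfl)
    omega
  rw [Hr, this, pr_empty]

lemma Hev_anti {w w' h : ℕ} (hw : w ≤ w') : Hev w' h ⊆ Hev w h := by
  rintro ω ⟨s, t, h1, h2, v, ⟨h3, h4, h5, h6⟩, hn, ho⟩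
  have := cross_Hev (c := 0) (w := w) (r := 0) (h := h) hn ho h1 (by rw [h3]; simpa using h5)
    (by omega) (by omega) (by simp) (by omega) (by omega)
  have e : sh 0 0 = id := by ext ⟨a, b, c⟩ <;> simp [sh]
  rw [e] at this
  exact this

lemma cols (p : ℝ) {w : ℕ} (h k : ℕ) :
    pr p {ω | ∀ j < k, ω ∈ reix (sh (j*w) 0) (Hev w h)} ≤ Hr p w h ^ k ∧
    FD {ω | ∀ j < k, ω ∈ reix (sh (j*w) 0) (Hev w h)} ∧
    Dep {b : B | b.1 ≤ k * w ∧ b.2.2 ≤ k * w ∧ b.1 ≠ b.2.2}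
      {ω | ∀ j < k, ω ∈ reix (sh (j*w) 0) (Hev w h)} := by
  induction k with
  | zero =>
    have : {ω : Cf | ∀ j < 0, ω ∈ reix (sh ((j:ℕ)*w) 0) (Hev w h)} = Set.univ := by ext; simp
    rw [this]
    exact ⟨by simp [pr_univ], FD.univ, fun _ _ _ h => h⟩
  | succ k ih =>
    obtain ⟨i1, i2, i3⟩ := ih
    have e : {ω : Cf | ∀ j < k+1, ω ∈ reix (sh (j*w) 0) (Hev w h)} =
      {ω : Cf | ∀ j < k, ω ∈ reix (sh (j*w) 0) (Hev w h)} ∩ reix (sh (k*w) 0) (Hev w h) := by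
      ext ω
      constructor
      · intro h; exact ⟨fun j hj => h j (by omega), h k (by omega)⟩
      · rintro ⟨h1, h2⟩ j hj
        rcases Nat.lt_succ_iff_lt_or_eq.1 hj with h | h
        · exact h1 j h
        · rw [h]; exact h2
    have d := (Hev_dep w h).reix (f := sh (k*w) 0)
    have fd := (Hev_FD w h).reix (f := sh (k*w) 0)
    rw [e]
    refine ⟨?_, i2.inter fd, ?_⟩
    · rw [indep p i2 fd i3 d, pr_reix p (sh_inj _ _) (Hev_FD w h), pow_succ]
      · exact mul_le_mul_of_nonneg_right i1 (pr_nonneg _ _)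
      · rw [Set.disjoint_left]
        rintro ⟨x, s, y⟩ ⟨a1, a2, a3⟩ ⟨⟨x', s', y'⟩, ⟨b1, b2, b3, b4, b5, b6⟩, b7⟩
        simp only [sh, Prod.mk.injEq] at *
        omega
    · refine Dep.inter (i3.mono ?_) (d.mono ?_)
      · rintro ⟨x, s, y⟩ ⟨a1, a2, a3⟩
        simp only at a1 a2 a3
        have : ((k+1:ℕ):ℤ) * w = k * w + w := by push_cast; ring
        refine ⟨?_, ?_, a3⟩ <;> simp only [this] <;> omega
      · rintro _ ⟨⟨x', s', y'⟩, ⟨b1, b2, b3, b4, b5, b6⟩, rfl⟩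
        simp only [sh] at *
        have : ((k+1:ℕ):ℤ) * w = k * w + w := by push_cast; ring
        refine ⟨?_, ?_, ?_⟩ <;> simp only [this] <;> omega

lemma F_le_pow (p : ℝ) {w T k m : ℕ} {y : ℤ} (hw : Even w) (hm : m ≤ T) (hy : (k * w : ℤ) ≤ y) :
    F p m y ≤ Hr p w T ^ k := by
  refine (pr_mono p ?_).trans (cols p T k).1
  rintro ω ⟨v, ⟨h1, h2, h3⟩, hn, ho⟩ j hj
  have hjk : ((j:ℤ) + 1) * w ≤ k * w := by
    have : (j:ℤ) + 1 ≤ k := by omega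
    exact mul_le_mul_of_nonneg_right this (by omega)
  refine cross_Hev hn ho (Nat.zero_le m) h2 (c := j * w) (w := w) (r := 0) ?_ ?_ ?_ le_rfl (by omega)
  · have : (0:ℤ) ≤ j * w := by positivity
    omega
  · have : (j:ℤ) * w + w = (j+1) * w := by ring
    omega
  · have : Even (w:ℤ) := by exact_mod_cast hw
    simpa using this.mul_left _

/-! ### Survival probability, two-point function -/

/-- survival probability -/
noncomputable def th (p : ℝ) (n : ℕ) : ℝ := pr p (Pe 0 n (fun v => v 0 = 0))
/-- two-point function -/
noncomputable def ta (p : ℝ) (x : ℤ) (n : ℕ) : ℝ := pr p (Pe 0 n (fun v => v 0 = 0 ∧ v n = x))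

lemma norm1_one (x : Fin 1 → ℤ) : norm1 x = |x 0| := by simp [norm1]

lemma conn_iff (ω : Config 1) (y : Fin 1 → ℤ) (t : ℕ) :
    Connected ω 0 0 y t ↔ pull ω ∈ Pe 0 t (fun v => v 0 = 0 ∧ v t = y 0) := by
  constructor
  · rintro (⟨h1, h2, h3⟩ | ⟨h1, v, h2, h3, h4, h5⟩)
    · subst h1 h2
      exact ⟨fun _ => 0, ⟨rfl, rfl⟩, fun j _ h => by omega, fun j _ h => by omega⟩
    · refine ⟨fun j => v j 0, ⟨by simp [h2], by simp [h3]⟩, fun j hj hj' => ?_, fun j hj hj' => ?_⟩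
      · have := (h5 j hj hj').1
        rw [norm1_one, abs_eq (by norm_num)] at this
        simp only [Pi.sub_apply] at this
        dsimp only
        omega
      · have := (h5 j hj hj').2
        have e : ∀ k, (fun _ : Fin 1 => v k 0) = v k := fun k => by
          ext i; fin_cases i; rfl
        simpa only [pull, e] using this
  · rintro ⟨v, ⟨h1, h2⟩, h3, h4⟩
    rcases Nat.eq_zero_or_pos t with h | h
    · left
      subst h
      refine ⟨?_, rfl, trivial⟩
      ext i; fin_cases i
      simp only [Pi.zero_apply]
      rw [← h1, h2]; rfl
    · right
      refine ⟨h, fun j _ => v j, ?_, ?_, fun _ _ _ => trivial, fun j hj hj' => ⟨?_, h4 j hj hj'⟩⟩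
      · ext i; simp [h1]
      · ext i; fin_cases i; simp [h2]
      · rw [norm1_one, abs_eq (by norm_num)]
        have := h3 j hj hj'
        simp only [Pi.sub_apply]
        omega

lemma FD_start (s t : ℕ) (x : ℤ) : FD (Pe s t (fun v => v s = x)) :=
  FD_Pe |x| (fun v h _ => by rw [h])

lemma FD_two (n : ℕ) (x : ℤ) : FD (Pe 0 n (fun v => v 0 = 0 ∧ v n = x)) :=
  FD_Pe 0 (fun v h _ => by rw [h.1]; simp)

lemma FD_end {s t : ℕ} (hst : s ≤ t) (x : ℤ) : FD (Pe s t (fun v => v t = x)) :=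
  FD_Pe (|x| + t) (fun v h hn => by
    have := abs_le.1 (hn.bd le_rfl hst le_rfl)
    have h1 := le_abs_self x
    have h2 := neg_abs_le x
    rw [abs_le]; omega)

lemma P_pull (p : ℝ) {E : Set Cf} (h : FD E) : (P 1 p {ω | pull ω ∈ E}).toReal = pr p E := by
  rw [pr, Measure.real, ← P_map, Measure.map_apply measurable_pull h.meas]
  rfl

lemma theta_eq (p : ℝ) (n : ℕ) : theta 1 p n = th p n := by
  rw [theta, th, ← P_pull p (FD_start 0 n 0)]
  congr 2
  ext ω
  simp only [Set.mem_ofPred_eq, conn_iff]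
  constructor
  · rintro ⟨y, v, ⟨h1, h2⟩, h3, h4⟩
    exact ⟨v, h1, h3, h4⟩
  · rintro ⟨v, h1, h3, h4⟩
    exact ⟨fun _ => v n, v, ⟨h1, rfl⟩, h3, h4⟩

lemma tau_eq (p : ℝ) (x : Fin 1 → ℤ) (n : ℕ) : tau 1 p x n = ta p (x 0) n := by
  rw [tau, ta, ← P_pull p (FD_two n (x 0))]
  congr 2
  ext ω
  simp only [Set.mem_ofPred_eq, conn_iff]

lemma ta_zero (p : ℝ) {x : ℤ} {n : ℕ} (h : x < -n ∨ (n:ℤ) < x ∨ ¬ Even (x + n)) : ta p x n = 0 := by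
  have : Pe 0 n (fun v => v 0 = 0 ∧ v n = x) = ∅ := by
    ext ω
    simp only [Set.mem_empty_iff_false, iff_false]
    rintro ⟨v, ⟨h1, h2⟩, hn, _⟩
    have h3 := abs_le.1 (hn.bd le_rfl (Nat.zero_le n) le_rfl)
    have h4 := (hn.par le_rfl (Nat.zero_le n) le_rfl).2 (by rw [h1]; simp)
    rw [h2] at h4
    push_cast at h3
    rcases h with h | h | h
    · omega
    · omega
    · exact h h4
  rw [ta, this, pr_empty]

/-- sum over integer points of a function supported in `[-n,n]` -/
lemma tsum_fin (f : ℤ → ℝ) (n : ℕ) (h : ∀ x : ℤ, x < -(n:ℤ) ∨ (n:ℤ) < x → f x = 0) :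
    ∑' x : Fin 1 → ℤ, f (x 0) = ∑ x ∈ Finset.Icc (-(n:ℤ)) n, f x := by
  have e := (Equiv.funUnique (Fin 1) ℤ).tsum_eq f
  have e2 : (fun x : Fin 1 → ℤ => f ((Equiv.funUnique (Fin 1) ℤ) x)) = fun x => f (x 0) := by
    ext x; rfl
  rw [e2] at e
  rw [e]
  apply tsum_eq_sum
  intro x hx
  apply h
  rw [Finset.mem_Icc] at hx
  omega

/-- expected size -/
noncomputable def ch (p : ℝ) (n : ℕ) : ℝ := ∑ x ∈ Finset.Icc (-(n:ℤ)) n, ta p x n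
/-- second moment -/
noncomputable def sm (p : ℝ) (n : ℕ) : ℝ := ∑ x ∈ Finset.Icc (-(n:ℤ)) n, (x:ℝ)^2 * ta p x n

lemma chi_eq (p : ℝ) (n : ℕ) : chi 1 p n = ch p n := by
  rw [chi, ch, ← tsum_fin]
  · congr 1; ext x; exact tau_eq p x n
  · intro x hx; exact ta_zero p (by tauto)

lemma xi_eq (p : ℝ) (n : ℕ) : xi 1 p n = Real.sqrt (sm p n / ch p n) := by
  rw [xi, chi_eq, sm, ← tsum_fin]
  · congr 2
    congr 1
    ext x
    rw [tau_eq]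
    simp [normSq]
  · intro x hx; rw [ta_zero p (by tauto), mul_zero]

lemma ta_nonneg (p : ℝ) (x : ℤ) (n : ℕ) : 0 ≤ ta p x n := pr_nonneg _ _
lemma th_nonneg (p : ℝ) (n : ℕ) : 0 ≤ th p n := pr_nonneg _ _
lemma th_le_one (p : ℝ) (n : ℕ) : th p n ≤ 1 := pr_le_one _ _

lemma th_lower {p : ℝ} (hp : p ∈ Set.Icc (0:ℝ) 1) (n : ℕ) : p ^ n ≤ th p n := by
  refine (pr_Op hp n (fun j => (j:ℤ))).trans (pr_mono p ?_)
  intro ω h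
  exact ⟨fun j => (j:ℤ), by simp, fun j _ _ => by left; push_cast; ring, h⟩

lemma th_anti (p : ℝ) {m n : ℕ} (h : m ≤ n) : th p n ≤ th p m := by
  apply pr_mono
  rintro ω ⟨v, h1, h2, h3⟩
  exact ⟨v, h1, h2.sub le_rfl h, h3.sub le_rfl h⟩

lemma th_le_ch (p : ℝ) (n : ℕ) : th p n ≤ ch p n := by
  refine le_trans ?_ (pr_biUnion p (Finset.Icc (-(n:ℤ)) n) (fun x => Pe 0 n (fun v => v 0 = 0 ∧ v n = x)))
  apply pr_mono
  rintro ω ⟨v, h1, h2, h3⟩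
  have := abs_le.1 (h2.bd le_rfl (Nat.zero_le n) le_rfl)
  push_cast at this
  simp only [Set.mem_iUnion]
  exact ⟨v n, by rw [Finset.mem_Icc]; omega, v, ⟨h1, rfl⟩, h2, h3⟩

lemma pr_start (p : ℝ) (s n : ℕ) (x : ℤ) : pr p (Pe s (n + s) (fun v => v s = x)) = th p n := by
  rw [th, ← pr_sh p x s 0 n _ (FD_start 0 n 0), Nat.zero_add]
  congr 2; ext v; beta_reduce; rw [Nat.zero_add]; omega

lemma pr_end0 (p : ℝ) (n : ℕ) (x : ℤ) : pr p (Pe 0 n (fun v => v n = x)) = th p n := by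
  have := pr_rev p n (fun a _ => a = x) (FD_start 0 n x)
  rw [this]
  exact pr_start p 0 n x

lemma pr_end (p : ℝ) (s n : ℕ) (x : ℤ) : pr p (Pe s (n + s) (fun v => v (n + s) = x)) = th p n := by
  rw [← pr_end0 p n x, ← pr_sh p 0 s 0 n _ (FD_end (Nat.zero_le n) x), Nat.zero_add]
  congr 2; ext v; beta_reduce; omega

lemma ta_le (p : ℝ) (x : ℤ) (a b : ℕ) : ta p x (b + a) ≤ th p a * th p b := by
  have hi := indep p (FD_start 0 a 0) (FD_end (by omega : a ≤ b + a) x)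
    (Dep_time (s := 0) (t := a) _) (Dep_time (s := a) (t := b + a) _) (by
      rw [Set.disjoint_left]
      rintro b ⟨_, h1⟩ ⟨h2, _⟩
      omega)
  rw [pr_end] at hi
  rw [th, ← hi]
  apply pr_mono
  rintro ω ⟨v, ⟨h1, h2⟩, h3, h4⟩
  exact ⟨⟨v, h1, h3.sub le_rfl (by omega), h4.sub le_rfl (by omega)⟩,
    ⟨v, h2, h3.sub (by omega) le_rfl, h4.sub (by omega) le_rfl⟩⟩

lemma ta_bond {p : ℝ} (hp : p ∈ Set.Icc (0:ℝ) 1) (x y : ℤ) (n : ℕ) :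
    pr p (Pe 0 n (fun v => v 0 = 0 ∧ v n = x) ∩ {ω | ω (x, n, y) = true}) = p * ta p x n := by
  have hi := indep p (FD_two n x) (FD_bond (x,n,y)) (Dep_time (s := 0) (t := n) _)
    (T := {(x,n,y)}) (by
      intro ω ω' h h'
      have := h (x,n,y) rfl
      simp only [Set.mem_ofPred_eq] at h' ⊢
      rw [← this, h']) (by
      rw [Set.disjoint_left]
      rintro b ⟨_, h1⟩ h2
      simp only [Set.mem_singleton_iff] at h2
      rw [h2] at h1
      simp at h1)
  rw [hi, pr_bond hp, ta, mul_comm]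

lemma ta_succ_ge {p : ℝ} (hp : p ∈ Set.Icc (0:ℝ) 1) (x y : ℤ) (n : ℕ) (hxy : y = x + 1 ∨ y = x - 1) :
    p * ta p x n ≤ ta p y (n+1) := by
  rw [← ta_bond hp x y n]
  apply pr_mono
  rintro ω ⟨⟨v, ⟨h1, h2⟩, h3, h4⟩, h5⟩
  have e : v n = (fun j => if j ≤ n then x else y) n := by simp [h2]
  refine ⟨spl n v (fun j => if j ≤ n then x else y), ⟨?_, ?_⟩, ?_, ?_⟩
  · rw [spl_le (Nat.zero_le n), h1]
  · rw [spl_ge e (by omega)]; simp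
  · refine spl_NN h3 ?_ e
    intro j hj hj'
    have : j = n := by omega
    subst this
    simpa using hxy
  · refine spl_Op h4 ?_ e
    intro j hj hj'
    have : j = n := by omega
    subst this
    simpa using h5

lemma ta_succ_le {p : ℝ} (hp : p ∈ Set.Icc (0:ℝ) 1) (x : ℤ) (n : ℕ) :
    ta p x (n+1) ≤ p * ta p (x-1) n + p * ta p (x+1) n := by
  rw [← ta_bond hp (x-1) x n, ← ta_bond hp (x+1) x n]
  refine le_trans (pr_mono p ?_) (pr_union p _ _)
  rintro ω ⟨v, ⟨h1, h2⟩, h3, h4⟩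
  have a := h3 n (by omega) (by omega)
  have b := h4 n (by omega) (by omega)
  rcases a with a | a
  · left
    refine ⟨⟨v, ⟨h1, by omega⟩, h3.sub le_rfl (by omega), h4.sub le_rfl (by omega)⟩, ?_⟩
    have : v n = x - 1 := by omega
    rw [h2, this] at b
    exact b
  · right
    refine ⟨⟨v, ⟨h1, by omega⟩, h3.sub le_rfl (by omega), h4.sub le_rfl (by omega)⟩, ?_⟩
    have : v n = x + 1 := by omega
    rw [h2, this] at b
    exact b

lemma sum_shift_le {p : ℝ} (n : ℕ) (a b c : ℤ) : ∑ x ∈ Finset.Icc a b, ta p (x + c) n ≤ ch p n := by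
  have e : ∑ x ∈ Finset.Icc a b, ta p (x + c) n = ∑ x ∈ Finset.Icc (a + c) (b + c), ta p x n := by
    rw [← Finset.image_add_right_Icc, Finset.sum_image]
    intro x _ y _ h
    exact add_right_cancel h
  rw [e, ch]
  rw [← Finset.sum_inter_add_sum_sdiff (Finset.Icc (a + c) (b + c)) (Finset.Icc (-(n:ℤ)) n)]
  have z : ∑ x ∈ Finset.Icc (a + c) (b + c) \ Finset.Icc (-(n:ℤ)) n, ta p x n = 0 := by
    apply Finset.sum_eq_zero
    intro x hx
    simp only [Finset.mem_sdiff, Finset.mem_Icc] at hx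
    exact ta_zero p (by omega)
  rw [z, add_zero]
  exact Finset.sum_le_sum_of_subset_of_nonneg Finset.inter_subset_right (fun x _ _ => ta_nonneg p x n)

lemma ch_le {p : ℝ} (hp : p ∈ Set.Icc (0:ℝ) 1) (n : ℕ) : ch p n ≤ (2 * p) ^ n := by
  induction n with
  | zero =>
    simp only [ch, Nat.cast_zero, neg_zero, Finset.Icc_self, Finset.sum_singleton, pow_zero]
    exact pr_le_one _ _
  | succ n ih =>
    have h0 := hp.1
    calc ch p (n+1) ≤ ∑ x ∈ Finset.Icc (-((n+1:ℕ):ℤ)) (n+1:ℕ), (p * ta p (x+(-1)) n + p * ta p (x+1) n) :=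
          Finset.sum_le_sum (fun x _ => ta_succ_le hp x n)
      _ ≤ p * ch p n + p * ch p n := by
          rw [Finset.sum_add_distrib, ← Finset.mul_sum, ← Finset.mul_sum]
          gcongr
          · exact sum_shift_le n _ _ _
          · exact sum_shift_le n _ _ _
      _ = 2 * p * ch p n := by ring
      _ ≤ 2 * p * (2 * p) ^ n := by gcongr
      _ = (2 * p)^(n+1) := by ring

lemma ta_origin {p : ℝ} (hp : p ∈ Set.Icc (0:ℝ) 1) (n : ℕ) (hn : 1 ≤ n) :
    ta p 0 n ≤ ta p 2 n + ta p (-2) n := by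
  obtain ⟨m, rfl⟩ : ∃ m, n = m + 1 := ⟨n - 1, by omega⟩
  have h1 := ta_succ_le hp 0 m
  have h2 := ta_succ_ge hp 1 2 m (by norm_num)
  have h3 := ta_succ_ge hp (-1) (-2) m (by norm_num)
  norm_num at h1
  linarith

lemma ch_le_sm {p : ℝ} (hp : p ∈ Set.Icc (0:ℝ) 1) (n : ℕ) (hn : 1 ≤ n) : ch p n ≤ 2 * sm p n := by
  have h0 : (0:ℤ) ∈ Finset.Icc (-(n:ℤ)) n := by rw [Finset.mem_Icc]; omega
  have h1 : ch p n = ta p 0 n + ∑ x ∈ (Finset.Icc (-(n:ℤ)) n).erase 0, ta p x n := by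
    rw [ch]; exact (Finset.add_sum_erase _ (fun x => ta p x n) h0).symm
  have h2 : ∑ x ∈ (Finset.Icc (-(n:ℤ)) n).erase 0, ta p x n ≤ sm p n := by
    refine le_trans ?_ (Finset.sum_le_sum_of_subset_of_nonneg (f := fun x : ℤ => (x:ℝ)^2 * ta p x n)
      (Finset.erase_subset 0 _) (fun x _ _ => mul_nonneg (sq_nonneg _) (ta_nonneg p x n)))
    apply Finset.sum_le_sum
    intro x hx
    have : x ≠ 0 := (Finset.mem_erase.1 hx).1
    have h3 : (1:ℝ) ≤ (x:ℝ)^2 := by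
      have : 1 ≤ x^2 := by
        have := sq_pos_of_ne_zero this
        omega
      exact_mod_cast this
    have := ta_nonneg p x n
    nlinarith
  have h3 : ta p 0 n ≤ ∑ x ∈ (Finset.Icc (-(n:ℤ)) n).erase 0, ta p x n := by
    rcases Nat.eq_or_lt_of_le hn with h | h
    · rw [ta_zero p (x := 0) (n := n) (by right; right; rw [← h]; decide)]
      exact Finset.sum_nonneg (fun x _ => ta_nonneg p x n)
    · have hs : ({2, -2} : Finset ℤ) ⊆ (Finset.Icc (-(n:ℤ)) n).erase 0 := by
        intro x hx
        simp only [Finset.mem_insert, Finset.mem_singleton] at hx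
        rw [Finset.mem_erase, Finset.mem_Icc]
        omega
      have := Finset.sum_le_sum_of_subset_of_nonneg (f := fun x => ta p x n) hs (fun x _ _ => ta_nonneg p x n)
      rw [Finset.sum_pair (by norm_num)] at this
      exact (ta_origin hp n hn).trans this
  linarith

/-- lower bound on the two-point function by planarity -/
lemma ta_lower {p : ℝ} (hp : p ∈ Set.Icc (0:ℝ) 1) (x : ℤ) (n : ℕ) (hx : Even (x + n)) :
    th p n ^ 2 * F p n |x| ^ 2 ≤ ta p x n := by
  have hA1 := FD_start 0 n 0
  have hA2 := FD_G (Nat.zero_le n) 0 x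
  have hA3 := FD_Gm (Nat.zero_le n) 0 x
  have hA4 := FD_end (Nat.zero_le n) x
  have k1 := harris hp hA1 hA4 (Pe_up _ _ _) (Pe_up _ _ _)
  have k2 := harris hp hA2 hA3 (Pe_up _ _ _) (Pe_up _ _ _)
  have k3 := harris hp (hA1.inter hA4) (hA2.inter hA3) ((Pe_up _ _ _).inter (Pe_up _ _ _))
    ((Pe_up _ _ _).inter (Pe_up _ _ _))
  rw [pr_end0] at k1
  change th p n * th p n ≤ _ at k1
  change F p n x * _ ≤ _ at k2
  rw [Gm_eq' p (Nat.zero_le n) x (by simp)] at k2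
  have f1 : F p n |x| ≤ F p n x := F_anti p n (le_abs_self x)
  have f2 : F p n |x| ≤ F p (n-0) (0-x) := F_anti p n (by rw [zero_sub]; exact neg_le_abs x)
  have f0 := F_nonneg p n |x|
  have f3 := F_nonneg p n x
  have t0 := th_nonneg p n
  have k4 : th p n ^ 2 * F p n |x| ^ 2 ≤ (th p n * th p n) * (F p n x * F p (n-0) (0-x)) := by
    rw [sq, sq]
    gcongr
  refine k4.trans ((mul_le_mul k1 k2 (mul_nonneg (F_nonneg _ _ _) (F_nonneg _ _ _)) (pr_nonneg _ _)).trans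
    (k3.trans (pr_mono p ?_)))
  rintro ω ⟨⟨⟨a, a1, a2, a3⟩, ⟨e, e1, e2, e3⟩⟩, ⟨⟨g, ⟨g1, g2, g3⟩, g4, g5⟩, ⟨q, ⟨q1, q2, q3⟩, q4, q5⟩⟩⟩
  have epar : Even (e 0) := by
    have := (e2.par le_rfl (Nat.zero_le n) le_rfl).1 (by rw [e1]; exact hx)
    simpa using this
  have gpar : Even (g 0) := by simpa using g2
  have qpar : Even (q 0) := by simpa using q2
  -- a path from the origin ending to the right of `x`
  have hR : ∃ b : ℕ → ℤ, b 0 = 0 ∧ x ≤ b n ∧ NN 0 n b ∧ Op ω 0 n b := by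
    by_cases h : x ≤ a n
    · exact ⟨a, a1, h, a2, a3⟩
    · obtain ⟨c, c1, c2, c3⟩ := meet g4 a2 (Nat.zero_le n) (by rw [a1, add_zero]; exact gpar) (by omega) (by omega)
      refine ⟨spl c a g, ?_, ?_, spl_NN (a2.sub le_rfl c2) (g4.sub c1 le_rfl) c3.symm,
        spl_Op (a3.sub le_rfl c2) (g5.sub c1 le_rfl) c3.symm⟩
      · rw [spl_le c1, a1]
      · rw [spl_ge c3.symm c2]; exact g3
  have hL : ∃ b : ℕ → ℤ, b 0 = 0 ∧ b n ≤ x ∧ NN 0 n b ∧ Op ω 0 n b := by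
    by_cases h : a n ≤ x
    · exact ⟨a, a1, h, a2, a3⟩
    · obtain ⟨c, c1, c2, c3⟩ := meet a2 q4 (Nat.zero_le n) (by rw [a1, zero_add]; exact qpar) (by omega) (by omega)
      refine ⟨spl c a q, ?_, ?_, spl_NN (a2.sub le_rfl c2) (q4.sub c1 le_rfl) c3,
        spl_Op (a3.sub le_rfl c2) (q5.sub c1 le_rfl) c3⟩
      · rw [spl_le c1, a1]
      · rw [spl_ge c3 c2]; exact q3
  have fin : ∀ b : ℕ → ℤ, b 0 = 0 → NN 0 n b → Op ω 0 n b → (∃ c, 0 ≤ c ∧ c ≤ n ∧ b c = e c) →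
      ω ∈ Pe 0 n (fun v => v 0 = 0 ∧ v n = x) := by
    rintro b b1 b2 b3 ⟨c, c1, c2, c3⟩
    refine ⟨spl c b e, ⟨?_, ?_⟩, spl_NN (b2.sub le_rfl c2) (e2.sub c1 le_rfl) c3,
        spl_Op (b3.sub le_rfl c2) (e3.sub c1 le_rfl) c3⟩
    · rw [spl_le c1, b1]
    · rw [spl_ge c3 c2]; exact e1
  by_cases h : e 0 ≤ 0
  · obtain ⟨b, b1, b2, b3, b4⟩ := hL
    obtain ⟨c, c1, c2, c3⟩ := meet e2 b3 (Nat.zero_le n) (by rw [b1, add_zero]; exact epar) (by omega) (by omega)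
    exact fin b b1 b3 b4 ⟨c, c1, c2, c3.symm⟩
  · obtain ⟨b, b1, b2, b3, b4⟩ := hR
    obtain ⟨c, c1, c2, c3⟩ := meet b3 e2 (Nat.zero_le n) (by rw [b1, zero_add]; exact epar) (by omega) (by omega)
    exact fin b b1 b3 b4 ⟨c, c1, c2, c3⟩

/-! ### Upper bound by Chebyshev -/

lemma th_pos {p : ℝ} (hp : p ∈ Set.Icc (0:ℝ) 1) (h0 : 0 < p) (n : ℕ) : 0 < th p n :=
  (pow_pos h0 n).trans_le (th_lower hp n)

lemma ch_pos {p : ℝ} (hp : p ∈ Set.Icc (0:ℝ) 1) (h0 : 0 < p) (n : ℕ) : 0 < ch p n :=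
  (th_pos hp h0 n).trans_le (th_le_ch p n)

lemma sm_nonneg (p : ℝ) (n : ℕ) : 0 ≤ sm p n :=
  Finset.sum_nonneg (fun x _ => mul_nonneg (sq_nonneg _) (ta_nonneg p x n))

/-- gyration radius -/
noncomputable def gy (p : ℝ) (n : ℕ) : ℝ := Real.sqrt (sm p n / ch p n)

lemma gy_sq {p : ℝ} (n : ℕ) : gy p n ^ 2 = sm p n / ch p n :=
  Real.sq_sqrt (div_nonneg (sm_nonneg _ _) (Finset.sum_nonneg (fun x _ => ta_nonneg p x n)))

lemma gy_lower {p : ℝ} (hp : p ∈ Set.Icc (0:ℝ) 1) (h0 : 0 < p) {n : ℕ} (hn : 1 ≤ n) :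
    1/2 ≤ gy p n := by
  apply Real.le_sqrt_of_sq_le
  rw [le_div_iff₀ (ch_pos hp h0 n)]
  have := ch_le_sm hp n hn
  have := ch_pos hp h0 n
  linarith

lemma ch_upper {p : ℝ} (hp : p ∈ Set.Icc (0:ℝ) 1) (h0 : 0 < p) {n : ℕ} (hn : 1 ≤ n) :
    ch p n ≤ 8 * gy p n * th p (n/2) ^ 2 := by
  have hc := ch_pos hp h0 n
  have hg := gy_lower hp h0 hn
  have hs : sm p n = gy p n ^ 2 * ch p n := by rw [gy_sq]; field_simp
  have ht0 := th_nonneg p (n/2)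
  set g := gy p n
  set t := th p (n/2)
  have hta : ∀ x, ta p x n ≤ t ^ 2 := by
    intro x
    have h1 := ta_le p x (n - n/2) (n/2)
    have e : n/2 + (n - n/2) = n := by omega
    rw [e] at h1
    have h2 : th p (n - n/2) ≤ t := th_anti p (by omega)
    calc ta p x n ≤ _ := h1
      _ ≤ t * t := mul_le_mul_of_nonneg_right h2 ht0
      _ = t^2 := by ring
  set r : ℤ := ⌊2 * g⌋
  have hr1 : (r:ℝ) ≤ 2 * g := Int.floor_le _
  have hr2 : 2 * g < r + 1 := Int.lt_floor_add_one _
  have hr0 : 0 ≤ r := by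
    have : (0:ℝ) < r + 1 := by linarith
    have : (0:ℤ) < r + 1 := by exact_mod_cast this
    omega
  have key : ∀ x : ℤ, ta p x n ≤ (if x ∈ Finset.Icc (-r) r then t^2 else 0) +
      ((x:ℝ)^2 * ta p x n) / (4 * g^2) := by
    intro x
    have hx := ta_nonneg p x n
    split_ifs with h
    · have : 0 ≤ ((x:ℝ)^2 * ta p x n) / (4 * g^2) := by positivity
      linarith [hta x]
    · rw [zero_add, le_div_iff₀ (by positivity)]
      have h1 : 4 * g^2 ≤ (x:ℝ)^2 := by
        have h2 : r + 1 ≤ |x| := by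
          rw [Finset.mem_Icc] at h
          rcases abs_cases x with h' | h' <;> omega
        have h3 : ((r:ℝ) + 1) ≤ |(x:ℝ)| := by exact_mod_cast h2
        rw [← sq_abs (x:ℝ)]
        nlinarith
      nlinarith
  have h1 : ch p n ≤ ∑ x ∈ Finset.Icc (-(n:ℤ)) n, (if x ∈ Finset.Icc (-r) r then t^2 else 0) +
      sm p n / (4 * g^2) := by
    rw [sm, Finset.sum_div, ← Finset.sum_add_distrib]
    exact Finset.sum_le_sum (fun x _ => key x)
  have h2 : ∑ x ∈ Finset.Icc (-(n:ℤ)) n, (if x ∈ Finset.Icc (-r) r then t^2 else 0) ≤ (2 * r + 1) * t^2 := by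
    rw [← Finset.sum_filter, Finset.sum_const, nsmul_eq_mul]
    apply mul_le_mul_of_nonneg_right _ (sq_nonneg t)
    have : (Finset.filter (fun x => x ∈ Finset.Icc (-r) r) (Finset.Icc (-(n:ℤ)) n)).card
        ≤ (Finset.Icc (-r) r).card := by
      apply Finset.card_le_card
      intro x hx
      exact (Finset.mem_filter.1 hx).2
    rw [Int.card_Icc] at this
    have h3 : ((Finset.filter (fun x => x ∈ Finset.Icc (-r) r) (Finset.Icc (-(n:ℤ)) n)).card : ℤ) ≤ 2 * r + 1 := by
      omega
    exact_mod_cast h3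
  have h3 : sm p n / (4 * g^2) = ch p n / 4 := by
    rw [hs]; field_simp
  rw [h3] at h1
  have h4 : (2 * r + 1) * t^2 ≤ (6 * g) * t^2 := by
    apply mul_le_mul_of_nonneg_right _ (sq_nonneg t)
    linarith
  linarith

/-! ### Consequences of (super)criticality -/

/-- the event that the cluster of the origin reaches `[z,∞)` at time `m` -/
def Ae (m : ℕ) (z : ℤ) : Set Cf := Pe 0 m (fun v => v 0 = 0 ∧ z ≤ v m)

lemma FD_Ae (m : ℕ) (z : ℤ) : FD (Ae m z) := FD_Pe 0 (fun v h _ => by rw [h.1]; simp)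

lemma Ae_mono (m : ℕ) {z z' : ℤ} (h : z ≤ z') : Ae m z' ⊆ Ae m z :=
  Pe_mono (fun v _ ⟨a, b⟩ => ⟨a, by omega⟩)

/-- its probability -/
noncomputable def ap (p : ℝ) (m : ℕ) (z : ℤ) : ℝ := pr p (Ae m z)

lemma ap_anti (p : ℝ) (m : ℕ) {z z' : ℤ} (h : z ≤ z') : ap p m z' ≤ ap p m z := pr_mono p (Ae_mono m h)

lemma ap_step_event (m n : ℕ) (z : ℤ) :
    Ae (m + n) z ⊆ ⋃ i ∈ Finset.range (2 * m + 1), ((Ae m (-m + i) \ Ae m (-m + i + 1)) ∩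
      G m (m + n) (-m + i) z) := by
  rintro ω ⟨v, ⟨h1, h2⟩, hn, ho⟩
  obtain ⟨y, hy1, hy2⟩ := Int.exists_greatest_of_bdd (P := fun y => ω ∈ Ae m y)
    ⟨m, by
      rintro y ⟨w, ⟨w1, w2⟩, w3, _⟩
      have := abs_le.1 (w3.bd le_rfl (Nat.zero_le m) le_rfl)
      push_cast at this
      omega⟩
    ⟨v m, ⟨v, ⟨h1, le_rfl⟩, hn.sub le_rfl (by omega), ho.sub le_rfl (by omega)⟩⟩
  have hvm : v m ≤ y := hy2 _ ⟨v, ⟨h1, le_rfl⟩, hn.sub le_rfl (by omega), ho.sub le_rfl (by omega)⟩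
  have b1 := abs_le.1 (hn.bd le_rfl (Nat.zero_le m) (by omega))
  have hy3 : y ≤ m := by
    obtain ⟨w, ⟨w1, w2⟩, w3, _⟩ := hy1
    have := abs_le.1 (w3.bd le_rfl (Nat.zero_le m) le_rfl)
    push_cast at this
    omega
  push_cast at b1
  simp only [Set.mem_iUnion]
  refine ⟨(y + m).toNat, by rw [Finset.mem_range]; omega, ?_⟩
  have e : (-(m:ℤ) + ((y + m).toNat : ℤ)) = y := by omega
  rw [e]
  refine ⟨⟨hy1, fun h => ?_⟩, ⟨v, ⟨hvm, ?_, h2⟩, hn.sub (by omega) le_rfl, ho.sub (by omega) le_rfl⟩⟩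
  · have := hy2 _ h
    omega
  · exact (hn.par le_rfl (Nat.zero_le m) (by omega)).2 (by rw [h1]; simp)

lemma FD.diff {E E' : Set Cf} (h : FD E) (h' : FD E') : FD (E \ E') := by
  rw [Set.sdiff_eq]; exact h.inter h'.compl

lemma Dep.diff {S : Set B} {E E' : Set Cf} (h : Dep S E) (h' : Dep S E') : Dep S (E \ E') := by
  rw [Set.sdiff_eq]; exact h.inter h'.compl

/-- truncated version of `F` -/
noncomputable def Fh (p : ℝ) (n M : ℕ) (d : ℤ) : ℝ := if d ≤ -(M:ℤ) then 1 else F p n d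

lemma Fh_anti (p : ℝ) (n M : ℕ) {d d' : ℤ} (h : d ≤ d') : Fh p n M d' ≤ Fh p n M d := by
  unfold Fh
  split_ifs
  · exact le_rfl
  · omega
  · exact F_le_one _ _ _
  · exact F_anti p n h

lemma ap_step (p : ℝ) (m n M : ℕ) (z : ℤ) :
    ap p (m + n) z ≤ ∑ i ∈ Finset.range (2 * m + 1),
      (ap p m (-m + i) - ap p m (-m + i + 1)) * Fh p n M (z - (-m + i)) := by
  refine (pr_mono p (ap_step_event m n z)).trans ((pr_biUnion p _ _).trans ?_)
  apply Finset.sum_le_sum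
  intro i _
  have hd := pr_diff p (FD_Ae m (-m + i + 1)) (Ae_mono m (by omega : (-m + i : ℤ) ≤ -m + i + 1))
  unfold Fh
  split_ifs with h
  · rw [mul_one, ap, ap, ← hd]
    exact pr_mono p Set.inter_subset_left
  · rw [indep p ((FD_Ae m _).diff (FD_Ae m _)) (FD_G (by omega) _ _)
      ((Dep_time (s := 0) (t := m) _).diff (Dep_time (s := 0) (t := m) _))
      (Dep_time (s := m) (t := m + n) _) (by
        rw [Set.disjoint_left]
        rintro b ⟨_, h1⟩ ⟨h2, _⟩
        omega), hd]
    have := G_le p (by omega : m ≤ m + n) (-m + i : ℤ) z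
    rw [Nat.add_sub_cancel_left] at this
    exact mul_le_mul_of_nonneg_left this (sub_nonneg.2 (ap_anti p m (by omega)))

lemma tele (a : ℤ → ℝ) (ha : Antitone a) (w c : ℤ) (k : ℕ) :
    ∑ i ∈ Finset.range k, (if w ≤ c + i then a (c + i) - a (c + i + 1) else 0) ≤ a w - a (max w (c + k)) := by
  induction k with
  | zero => simp only [Finset.range_zero, Finset.sum_empty]; exact sub_nonneg.2 (ha (le_max_left _ _))
  | succ k ih =>
    rw [Finset.sum_range_succ]
    split_ifs with h
    · rw [max_eq_right h] at ih
      rw [max_eq_right (by push_cast; omega)]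
      push_cast
      rw [← add_assoc]
      linarith
    · rw [max_eq_left (by omega)] at ih
      rw [max_eq_left (by push_cast; omega)]
      linarith

/-- increments of `Fh` -/
noncomputable def gg (p : ℝ) (n M : ℕ) (i : ℕ) : ℝ := Fh p n M (-M + i) - Fh p n M (-M + i + 1)

lemma gg_nonneg (p : ℝ) (n M i : ℕ) : 0 ≤ gg p n M i := sub_nonneg.2 (Fh_anti p n M (by omega))

lemma Fh_layer_aux (f : ℤ → ℝ) (d c : ℤ) (k : ℕ) (hd : c ≤ d) :
    ∑ i ∈ Finset.range k, (if d ≤ c + i then f (c + i) - f (c + i + 1) else 0) = f d - f (max d (c + k)) := by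
  induction k with
  | zero => simp [hd]
  | succ k ih =>
    rw [Finset.sum_range_succ, ih]
    split_ifs with h
    · rw [max_eq_right h, max_eq_right (by push_cast; omega)]
      push_cast
      rw [← add_assoc]
      ring
    · rw [max_eq_left (by omega), max_eq_left (by push_cast; omega)]
      ring

lemma Fh_layer (p : ℝ) (n M : ℕ) (d : ℤ) :
    Fh p n M d = ∑ i ∈ Finset.range (M + n + 1), (if d ≤ -M + i then gg p n M i else 0) := by
  by_cases hd : -(M:ℤ) ≤ d
  · have := Fh_layer_aux (Fh p n M) d (-M) (M + n + 1) hd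
    unfold gg
    rw [this]
    have : Fh p n M (max d (-(M:ℤ) + (M + n + 1 : ℕ))) = 0 := by
      rw [Fh, if_neg (by push_cast; omega)]
      apply F_zero_of_gt
      push_cast; omega
    rw [this, sub_zero]
  · have h0 := Fh_layer_aux (Fh p n M) (-M) (-M) (M + n + 1) le_rfl
    have h1 : Fh p n M (max (-(M:ℤ)) (-(M:ℤ) + (M + n + 1 : ℕ))) = 0 := by
      rw [Fh, if_neg (by push_cast; omega)]
      apply F_zero_of_gt
      push_cast; omega
    rw [h1, sub_zero] at h0
    have h2 : Fh p n M d = Fh p n M (-M) := by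
      rw [Fh, Fh, if_pos (by omega), if_pos le_rfl]
    rw [h2, ← h0]
    apply Finset.sum_congr rfl
    intro i _
    rw [if_pos (by omega), if_pos (by omega)]; rfl

lemma ap_conv (p : ℝ) (m n M : ℕ) (z : ℤ) :
    ap p (m + n) z ≤ ∑ k ∈ Finset.range (M + n + 1), gg p n M k * ap p m (z - (-M + k)) := by
  refine (ap_step p m n M z).trans ?_
  calc _ = ∑ k ∈ Finset.range (M + n + 1), gg p n M k * ∑ i ∈ Finset.range (2 * m + 1),
        (if z - (-M + k) ≤ -m + i then ap p m (-m + i) - ap p m (-m + i + 1) else 0) := by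
        simp_rw [Fh_layer p n M, Finset.mul_sum]
        rw [Finset.sum_comm]
        apply Finset.sum_congr rfl
        intro k _
        apply Finset.sum_congr rfl
        intro i _
        by_cases h : z - (-m + i) ≤ -M + k
        · rw [if_pos h, if_pos (by omega)]; ring
        · rw [if_neg h, if_neg (by omega)]; ring
    _ ≤ _ := by
        apply Finset.sum_le_sum
        intro k _
        apply mul_le_mul_of_nonneg_left _ (gg_nonneg _ _ _ _)
        refine (tele (ap p m) (fun a b h => ap_anti p m h) _ _ _).trans ?_
        have : 0 ≤ ap p m (max (z - (-M + k)) (-m + (2 * m + 1 : ℕ))) := pr_nonneg _ _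
        linarith

/-- exponential moment -/
noncomputable def ph (p : ℝ) (n M : ℕ) (s : ℝ) : ℝ :=
  ∑ k ∈ Finset.range (M + n + 1), gg p n M k * Real.exp (s * (-M + k))

lemma ap_exp (p : ℝ) (n M : ℕ) {s : ℝ} (hs : 0 ≤ s) (j : ℕ) (z : ℤ) :
    ap p (j * n) z ≤ ph p n M s ^ j * Real.exp (-(s * z)) := by
  induction j generalizing z with
  | zero =>
    rw [pow_zero, one_mul]
    by_cases hz : z ≤ 0
    · refine (pr_le_one _ _).trans (Real.one_le_exp ?_)
      have : (z:ℝ) ≤ 0 := by exact_mod_cast hz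
      nlinarith
    · have : Ae (0 * n) z = ∅ := by
        ext ω
        simp only [Set.mem_empty_iff_false, iff_false]
        rintro ⟨v, ⟨h1, h2⟩, _⟩
        rw [zero_mul] at h2
        omega
      rw [ap, this, pr_empty]
      positivity
  | succ j ih =>
    rw [Nat.succ_mul]
    refine (ap_conv p (j * n) n M z).trans ?_
    rw [pow_succ, ph, mul_assoc, Finset.sum_mul, Finset.mul_sum]
    apply Finset.sum_le_sum
    intro k _
    calc _ ≤ gg p n M k * (ph p n M s ^ j * Real.exp (-(s * (z - (-M + k) : ℤ)))) :=
          mul_le_mul_of_nonneg_left (ih _) (gg_nonneg _ _ _ _)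
      _ = _ := by
          have : Real.exp (-(s * (z - (-M + k) : ℤ))) = Real.exp (s * (-M + k)) * Real.exp (-(s * z)) := by
            rw [← Real.exp_add]; congr 1; push_cast; ring
          rw [this, ph]; ring

lemma abel (u f : ℕ → ℝ) (k : ℕ) :
    ∑ i ∈ Finset.range k, (f i - f (i+1)) * u i = u 0 * f 0 - u k * f k +
      ∑ i ∈ Finset.range k, (u (i+1) - u i) * f (i+1) := by
  induction k with
  | zero => simp
  | succ k ih => rw [Finset.sum_range_succ, Finset.sum_range_succ, ih]; ring

lemma gg_abel (p : ℝ) (n M : ℕ) (u : ℕ → ℝ) :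
    ∑ k ∈ Finset.range (M + n + 1), gg p n M k * u k = u 0 +
      ∑ k ∈ Finset.range (M + n), (u (k+1) - u k) * F p n (-M + 1 + k) := by
  have h := abel u (fun i => Fh p n M (-M + i)) (M + n + 1)
  have e : ∀ k : ℕ, Fh p n M (-M + (k + 1 : ℕ)) = F p n (-M + 1 + k) := by
    intro k
    rw [Fh, if_neg (by push_cast; omega)]
    congr 1; push_cast; ring
  have e0 : Fh p n M (-M + (0:ℕ)) = 1 := by rw [Fh, if_pos (by simp)]
  have e1 : F p n (-M + 1 + (M + n : ℕ)) = 0 := F_zero_of_gt p (by push_cast; omega)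
  simp only [e, e0] at h
  rw [Finset.sum_range_succ (fun i => (u (i+1) - u i) * F p n (-M + 1 + i)), e1] at h
  simp only [mul_zero, mul_one, sub_zero, add_zero] at h
  rw [← h]
  apply Finset.sum_congr rfl
  intro k _
  rw [gg, ← e]
  push_cast
  rw [add_assoc]

lemma ph_lt_one (p : ℝ) (n M : ℕ)
    (h : ∑ k ∈ Finset.range (M + n), F p n (-M + 1 + k) < M) : ∃ s : ℝ, 0 ≤ s ∧ ph p n M s < 1 := by
  have h1 := gg_abel p n M (fun _ => 1)
  have h2 := gg_abel p n M (fun k => -M + k)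
  simp only [sub_self, zero_mul, Finset.sum_const_zero, add_zero, mul_one] at h1
  simp only [Nat.cast_add, Nat.cast_one, Nat.cast_zero, add_zero] at h2
  have h3 : ∑ k ∈ Finset.range (M + n), (-(M:ℝ) + (k + 1) - (-M + k)) * F p n (-M + 1 + k) =
      ∑ k ∈ Finset.range (M + n), F p n (-M + 1 + k) := by
    apply Finset.sum_congr rfl; intro k _; ring
  rw [h3] at h2
  set S := ∑ k ∈ Finset.range (M + n), F p n (-M + 1 + k)
  set δ := (M:ℝ) - S
  have hδ : 0 < δ := sub_pos.2 h
  set N : ℝ := M + n + 1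
  have hN : 1 ≤ N := by
    have : (0:ℝ) ≤ M := Nat.cast_nonneg _
    have : (0:ℝ) ≤ n := Nat.cast_nonneg _
    simp only [N]; linarith
  have hδN : δ ≤ N := by
    have hS : 0 ≤ S := Finset.sum_nonneg (fun k _ => F_nonneg _ _ _)
    have : (0:ℝ) ≤ n := Nat.cast_nonneg _
    simp only [N, δ]; linarith
  set s := δ / (2 * N^2)
  have hs : 0 < s := by positivity
  have hsN : s * N ≤ 1 := by
    have : s * N = δ / (2 * N) := by simp only [s]; field_simp
    rw [this, div_le_one (by positivity)]; linarith
  refine ⟨s, hs.le, ?_⟩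
  have key : ph p n M s ≤ ∑ k ∈ Finset.range (M + n + 1), (gg p n M k * 1 + s * (gg p n M k * (-M + k)) +
      s^2 * N^2 * (gg p n M k * 1)) := by
    apply Finset.sum_le_sum
    intro k hk
    have hg := gg_nonneg p n M k
    have hk1 : |(-M + k : ℝ)| ≤ N := by
      have h1 : (k:ℝ) ≤ M + n := by
        rw [Finset.mem_range] at hk
        have : k ≤ M + n := by omega
        exact_mod_cast this
      have : (0:ℝ) ≤ M := Nat.cast_nonneg _
      have : (0:ℝ) ≤ n := Nat.cast_nonneg _
      have : (0:ℝ) ≤ k := Nat.cast_nonneg _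
      rw [abs_le]; constructor <;> simp only [N] <;> linarith
    have hx : |s * (-M + k : ℝ)| ≤ 1 := by
      rw [abs_mul, abs_of_pos hs]
      exact (mul_le_mul_of_nonneg_left hk1 hs.le).trans hsN
    have h5 := Real.abs_exp_sub_one_sub_id_le hx
    have h6 := (abs_le.1 h5).2
    have h7 : (s * (-M + k : ℝ))^2 ≤ s^2 * N^2 := by
      rw [mul_pow]
      apply mul_le_mul_of_nonneg_left _ (sq_nonneg s)
      rw [← sq_abs]
      exact pow_le_pow_left₀ (abs_nonneg _) hk1 2
    have : Real.exp (s * (-M + k)) ≤ 1 + s * (-M + k) + s^2 * N^2 := by linarith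
    calc _ ≤ gg p n M k * (1 + s * (-M + k) + s^2 * N^2) := mul_le_mul_of_nonneg_left this hg
      _ = _ := by ring
  rw [Finset.sum_add_distrib, Finset.sum_add_distrib, ← Finset.mul_sum, ← Finset.mul_sum, h2] at key
  simp only [mul_one, h1] at key
  have h8 : s * (-M + S) = - (s * δ) := by simp only [δ]; ring
  rw [h8] at key
  have h9 : s^2 * N^2 = s * δ / 2 := by simp only [s]; field_simp
  have : 0 < s * δ := mul_pos hs hδ
  linarith

lemma th_le_ap (p : ℝ) (m : ℕ) : th p m ≤ 2 * ap p m 0 := by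
  have h1 := pr_mir p 0 m _ (FD_Ae m 0)
  have h2 : Pe 0 m (fun v => v 0 = 0) ⊆ Ae m 0 ∪ Pe 0 m (fun v => -v 0 = 0 ∧ 0 ≤ -v m) := by
    rintro ω ⟨v, h, h'⟩
    rcases le_total 0 (v m) with h0 | h0
    · exact Or.inl ⟨v, ⟨h, h0⟩, h'⟩
    · exact Or.inr ⟨v, ⟨by omega, by omega⟩, h'⟩
  have h3 := (pr_mono p h2).trans (pr_union _ _ _)
  rw [h1] at h3
  change th p m ≤ ap p m 0 + ap p m 0 at h3
  linarith

lemma F1_super {p : ℝ} (hs : 0 < ⨅ t : ℕ, theta 1 p t) (n M : ℕ) :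
    (M:ℝ) ≤ ∑ k ∈ Finset.range (M + n), F p n (-M + 1 + k) := by
  by_contra hlt
  push Not at hlt
  obtain ⟨s, hs0, hs1⟩ := ph_lt_one p n M hlt
  have hp0 : 0 ≤ ph p n M s := Finset.sum_nonneg (fun k _ => mul_nonneg (gg_nonneg _ _ _ _) (Real.exp_pos _).le)
  obtain ⟨j, hj⟩ := exists_pow_lt_of_lt_one (half_pos hs) hs1
  have h1 := ap_exp p n M hs0 j 0
  have h2 := th_le_ap p (j * n)
  have h3 : ⨅ t : ℕ, theta 1 p t ≤ theta 1 p (j * n) :=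
    ciInf_le ⟨0, by rintro _ ⟨t, rfl⟩; simp only [theta_eq]; exact th_nonneg _ _⟩ _
  rw [theta_eq] at h3
  simp at h1
  linarith

lemma super_half {p : ℝ} (hp : p ∈ Set.Icc (0:ℝ) 1) (hs : 0 < ⨅ t : ℕ, theta 1 p t) : 1/2 ≤ p := by
  by_contra hlt
  push Not at hlt
  obtain ⟨j, hj⟩ := exists_pow_lt_of_lt_one hs (by linarith : 2 * p < 1)
  have h3 : ⨅ t : ℕ, theta 1 p t ≤ theta 1 p j :=
    ciInf_le ⟨0, by rintro _ ⟨t, rfl⟩; simp only [theta_eq]; exact th_nonneg _ _⟩ _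
  rw [theta_eq] at h3
  have := th_le_ch p j
  have := ch_le hp j
  linarith

lemma one_super : (1:ℝ) ∈ {p ∈ Set.Icc (0 : ℝ) 1 | 0 < ⨅ t : ℕ, theta 1 p t} := by
  refine ⟨by simp, ?_⟩
  have : ∀ t, theta 1 1 t = 1 := fun t => by
    rw [theta_eq]
    have := th_lower (p := 1) (by simp) t
    rw [one_pow] at this
    exact le_antisymm (th_le_one _ _) this
  simp [this]

lemma pc_mem : pc 1 ∈ Set.Icc (1/2:ℝ) 1 :=
  ⟨le_csInf ⟨1, one_super⟩ (fun p hp => super_half hp.1 hp.2),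
    csInf_le ⟨0, fun p hp => hp.1.1⟩ one_super⟩

lemma F_cont (n : ℕ) (y : ℤ) : ∃ f : ℝ → ℝ, Continuous f ∧ ∀ p ∈ Set.Icc (0:ℝ) 1, F p n y = f p :=
  pr_cont (FD_G (Nat.zero_le n) 0 y)

lemma F1 (n M : ℕ) : (M:ℝ) ≤ ∑ k ∈ Finset.range (M + n), F (pc 1) n (-M + 1 + k) := by
  by_contra hlt
  push Not at hlt
  choose f hf1 hf2 using F_cont n
  have hpc := pc_mem
  have hc : Continuous (fun p => ∑ k ∈ Finset.range (M + n), f (-M + 1 + k) p) :=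
    continuous_finsetSum _ (fun k _ => hf1 _)
  have hpc' : pc 1 ∈ Set.Icc (0:ℝ) 1 := ⟨by linarith [hpc.1], hpc.2⟩
  have h1 : ∑ k ∈ Finset.range (M + n), f (-M + 1 + k) (pc 1) < M := by
    simpa only [hf2 _ _ hpc'] using hlt
  have h2 := (hc.tendsto (pc 1)).eventually_lt_const h1
  obtain ⟨ε, hε, h3⟩ := Metric.eventually_nhds_iff.1 h2
  obtain ⟨p, hp, hp2⟩ := exists_lt_of_csInf_lt ⟨1, one_super⟩ (show sInf _ < pc 1 + ε from by
    change pc 1 < pc 1 + ε; linarith)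
  have hp3 : pc 1 ≤ p := csInf_le ⟨0, fun p hp => hp.1.1⟩ hp
  have h4 := h3 (y := p) (by rw [Real.dist_eq, abs_of_nonneg (by linarith)]; linarith)
  have h5 := F1_super hp.2 n M
  simp only [hf2 _ _ hp.1] at h5
  linarith

/-! ### The descent step for horizontal crossings -/

/-- vertical crossing of the column `[c-k,c+k]` -/
def Vc (h : ℕ) (c : ℤ) (k : ℕ) : Set Cf :=
  Pe 0 h (fun v => Even (v 0) ∧ ∀ j ≤ h, |v j - c| ≤ k)

lemma FD_Vc (h : ℕ) (c : ℤ) (k : ℕ) : FD (Vc h c k) := by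
  apply FD_Pe (|c| + k)
  rintro v ⟨_, h2⟩ _
  have h3 := h2 0 (Nat.zero_le h)
  have h4 := abs_sub_abs_le_abs_sub (v 0) c
  linarith

lemma Vc_eq (p : ℝ) (h : ℕ) {c : ℤ} (hc : Even c) (k : ℕ) : pr p (Vc h c k) = pr p (Vc h 0 k) := by
  have := pr_sh p c 0 0 h _ (FD_Vc h 0 k)
  rw [← Vc] at this
  rw [← this]
  simp only [Nat.add_zero, sub_zero, Int.even_sub, hc, iff_true]
  rfl

lemma confined {p : ℝ} (hp : p ∈ Set.Icc (0:ℝ) 1) (h m : ℕ) :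
    pr p (Vc h 0 (2 * m)) ^ 2 * Hr p (20 * m) h ≤ F p h (12 * m) := by
  have e1 : Even (2 * m : ℤ) := even_two_mul _
  have e2 : Even (18 * m : ℤ) := ⟨9 * m, by ring⟩
  have e3 : Even (4 * m : ℤ) := ⟨2 * m, by ring⟩
  have k1 := harris hp (FD_Vc h (2 * m) (2 * m)) (FD_Vc h (18 * m) (2 * m)) (Pe_up _ _ _) (Pe_up _ _ _)
  have k2 := harris hp ((FD_Vc h (2 * m) (2 * m)).inter (FD_Vc h (18 * m) (2 * m))) (Hev_FD (20 * m) h)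
    ((Pe_up _ _ _).inter (Pe_up _ _ _)) (Hev_up _ _)
  rw [Vc_eq p h e1, Vc_eq p h e2] at k1
  have k3 := G_eq p (Nat.zero_le h) (16 * m) (x := 4 * m) (by simpa using e3)
  have e4 : (16 * m - 4 * m : ℤ) = 12 * m := by ring
  rw [e4, Nat.sub_zero] at k3
  rw [← k3]
  have k4 : pr p (Vc h 0 (2 * m)) ^ 2 * Hr p (20 * m) h ≤
      pr p (Vc h (2 * m) (2 * m) ∩ Vc h (18 * m) (2 * m)) * pr p (Hev (20 * m) h) := by
    rw [sq]
    exact mul_le_mul_of_nonneg_right k1 (pr_nonneg _ _)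
  refine k4.trans (k2.trans (pr_mono p ?_))
  rintro ω ⟨⟨⟨a, ⟨a1, a2⟩, a3, a4⟩, ⟨b, ⟨b1, b2⟩, b3, b4⟩⟩, ⟨s, t, hst, hth, η, ⟨h1, h2, h3, h4⟩, h5, h6⟩⟩
  have pa : ∀ j ≤ h, Even (a j + j) := fun j hj =>
    (a3.par le_rfl (Nat.zero_le j) hj).2 (by simpa using a1)
  have pb : ∀ j ≤ h, Even (b j + j) := fun j hj =>
    (b3.par le_rfl (Nat.zero_le j) hj).2 (by simpa using b1)
  have pe : ∀ j, s ≤ j → j ≤ t → Even (η j + j) := fun j hj hj' =>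
    (h5.par le_rfl hj hj').2 (by rw [h1]; simpa using h3)
  have par2 : ∀ {x y : ℤ} {j : ℕ}, Even (x + j) → Even (y + j) → Even (x + y) := by
    intro x y j hx hy
    simp only [Int.even_add] at *
    tauto
  push_cast at *
  have as := abs_le.1 (a2 s (hst.trans hth))
  have at' := abs_le.1 (a2 t hth)
  obtain ⟨c1, c2, c3, c4⟩ := meet h5 (a3.sub (Nat.zero_le s) hth) hst
    (par2 (pe s le_rfl hst) (pa s (hst.trans hth))) (by omega) (by omega)
  have ac := abs_le.1 (a2 c1 (c3.trans hth))
  have bc := abs_le.1 (b2 c1 (c3.trans hth))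
  have bt := abs_le.1 (b2 t hth)
  obtain ⟨d1, d2, d3, d4⟩ := meet (h5.sub c2 le_rfl) (b3.sub (Nat.zero_le c1) hth) c3
    (par2 (pe c1 c2 c3) (pb c1 (c3.trans hth))) (by omega) (by omega)
  have a0 := abs_le.1 (a2 0 (Nat.zero_le h))
  have bh := abs_le.1 (b2 h le_rfl)
  have hd : spl c1 a η d1 = b d1 := by rw [spl_ge c4.symm d2, d4]
  refine ⟨spl d1 (spl c1 a η) b, ⟨?_, ?_, ?_⟩, ?_, ?_⟩
  · rw [spl_le (Nat.zero_le _), spl_le (Nat.zero_le _)]; omega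
  · rw [spl_le (Nat.zero_le _), spl_le (Nat.zero_le _)]; simpa using a1
  · rw [spl_ge hd (d3.trans hth)]; omega
  · exact spl_NN (spl_NN (a3.sub le_rfl (c3.trans hth)) (h5.sub c2 d3) c4.symm) (b3.sub (Nat.zero_le _) le_rfl) hd
  · exact spl_Op (spl_Op (a4.sub le_rfl (c3.trans hth)) (h6.sub c2 d3) c4.symm) (b4.sub (Nat.zero_le _) le_rfl) hd

/-- crossing on the right within the `j`-th time slab -/
def Cr (m h0 u : ℕ) : Set Cf := reix (sh (m + ((m + u) % 2 : ℕ)) u) (Hev m h0)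

lemma pr_Cr (p : ℝ) (m h0 u : ℕ) : pr p (Cr m h0 u) = Hr p m h0 := pr_reix p (sh_inj _ _) (Hev_FD _ _)

lemma pr_Cr_mir (p : ℝ) (m h0 u : ℕ) : pr p (reix mir (Cr m h0 u)) = Hr p m h0 := by
  have h : FD (Cr m h0 u) := (Hev_FD m h0).reix
  rw [pr_reix p mir_inj h, pr_Cr]

lemma swing {ω : Cf} {u t m h0 : ℕ} {v : ℕ → ℤ} (hn : NN u t v) (ho : Op ω u t v) (hut : u ≤ t)
    (hpar : Even (v u + u)) (h1 : v u ≤ m) (h2 : (2 * m : ℤ) < v t) (h3 : t ≤ u + h0) : ω ∈ Cr m h0 u := by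
  refine cross_Hev hn ho hut hpar ?_ ?_ ?_ le_rfl h3
  · omega
  · omega
  · rw [Int.even_iff]; omega

lemma swing_mir {ω : Cf} {u t m h0 : ℕ} {v : ℕ → ℤ} (hn : NN u t v) (ho : Op ω u t v) (hut : u ≤ t)
    (hpar : Even (v u + u)) (h1 : -m ≤ v u) (h2 : v t < -(2 * m : ℤ)) (h3 : t ≤ u + h0) :
    ω ∈ reix mir (Cr m h0 u) := by
  change (fun b => ω (mir b)) ∈ Cr m h0 u
  refine swing (v := fun j => - v j) (t := t) ?_ ?_ hut ?_ ?_ ?_ h3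
  · intro j hj hj'
    have := hn j hj hj'
    dsimp only
    omega
  · intro j hj hj'
    have := ho j hj hj'
    simpa only [mir, neg_neg] using this
  · rw [Int.even_iff] at *
    omega
  · omega
  · omega

lemma descent {p : ℝ} (hp : p ∈ Set.Icc (0:ℝ) 1) {K h h0 b m : ℕ} (hK : 5 ≤ K) (hh0 : 1 ≤ h0) (hh : h ≤ K * h0)
    (hbm : 2 * b ≤ m) (hE : 7/8 ≤ F p h (-b)) (hb : ∀ u ≤ h, F p u b ≤ 1 / (K:ℝ)^4)
    (hH : 1 / (K:ℝ)^2 ≤ Hr p (20 * m) h) : 1 / (K:ℝ)^2 ≤ Hr p m h0 := by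
  have hK' : (5:ℝ) ≤ K := by exact_mod_cast hK
  have hK4 : (16:ℝ) * K^2 < K^4 := by
    have h1 : (25:ℝ) ≤ K^2 := by nlinarith
    have h2 : (K:ℝ)^4 = K^2 * K^2 := by ring
    rw [h2]
    nlinarith
  -- not confined
  have hV : pr p (Vc h 0 (2 * m)) < 1/4 := by
    by_contra hlt
    push Not at hlt
    have h1 := confined hp h m
    have h2 : F p h (12 * m) ≤ 1 / (K:ℝ)^4 := (F_anti p h (by omega)).trans (hb h le_rfl)
    have h3 : (1/4)^2 * (1 / (K:ℝ)^2) ≤ pr p (Vc h 0 (2 * m)) ^ 2 * Hr p (20 * m) h := by gcongr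
    have h4 : 1 / (K:ℝ)^4 < (1/4)^2 * (1 / (K:ℝ)^2) := by
      have : (1/4)^2 * (1 / (K:ℝ)^2) = 1 / (16 * K^2) := by ring
      rw [this]
      exact one_div_lt_one_div_of_lt (by positivity) hK4
    linarith
  have hsub : G 0 h 0 (-b) ⊆ Vc h 0 (2 * m) ∪ ⋃ j ∈ Finset.range (K+1),
      ((G 0 (min (j * h0) h) 0 b ∪ G (min (j * h0) h) h (-(2 * b)) (-b)) ∪
        (Cr m h0 (min (j * h0) h) ∪ reix mir (Cr m h0 (min (j * h0) h)))) := by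
    rintro ω ⟨v, ⟨h1, h2, h3⟩, hn, ho⟩
    by_contra hno
    rw [Set.mem_union, not_or] at hno
    obtain ⟨n1, n2⟩ := hno
    simp only [Set.mem_iUnion, not_exists] at n2
    apply n1
    refine ⟨v, ⟨by simpa using h2, ?_⟩, hn, ho⟩
    intro t ht
    rw [sub_zero]
    set j := t / h0
    have hj1 : j * h0 ≤ t := Nat.div_mul_le_self t h0
    have hj2 : t ≤ j * h0 + h0 := (Nat.lt_div_mul_add (by omega)).le
    have hjK : j ≤ K := by
      apply Nat.div_le_of_le_mul
      rw [mul_comm]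
      exact ht.trans hh
    have n3 := n2 j (Finset.mem_range.2 (by omega))
    rw [min_eq_left (hj1.trans ht)] at n3
    set u := j * h0
    have hpar : Even (v u + u) := (hn.par le_rfl (Nat.zero_le u) (hj1.trans ht)).2 h2
    have m1 : v u < b := by
      by_contra hx
      push Not at hx
      exact n3 (Or.inl (Or.inl ⟨v, ⟨h1, h2, hx⟩, hn.sub le_rfl (hj1.trans ht), ho.sub le_rfl (hj1.trans ht)⟩))
    have m2 : -(2 * b : ℤ) < v u := by
      by_contra hx
      push Not at hx
      exact n3 (Or.inl (Or.inr ⟨v, ⟨hx, hpar, h3⟩, hn.sub (Nat.zero_le _) le_rfl, ho.sub (Nat.zero_le _) le_rfl⟩))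
    rw [abs_le]
    constructor
    · by_contra hx
      push Not at hx
      exact n3 (Or.inr (Or.inr (swing_mir (hn.sub (Nat.zero_le u) ht) (ho.sub (Nat.zero_le u) ht) hj1 hpar
        (by omega) (by push_cast at hx; omega) hj2)))
    · by_contra hx
      push Not at hx
      exact n3 (Or.inr (Or.inl (swing (hn.sub (Nat.zero_le u) ht) (ho.sub (Nat.zero_le u) ht) hj1 hpar
        (by omega) (by push_cast at hx; omega) hj2)))
  have hpr := (hE.trans (pr_mono p hsub)).trans (pr_union _ _ _)
  have hsum : pr p (⋃ j ∈ Finset.range (K+1),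
      ((G 0 (min (j * h0) h) 0 b ∪ G (min (j * h0) h) h (-(2 * b)) (-b)) ∪
        (Cr m h0 (min (j * h0) h) ∪ reix mir (Cr m h0 (min (j * h0) h))))) ≤
      ∑ j ∈ Finset.range (K+1), (2 * (1 / (K:ℝ)^4) + 2 * Hr p m h0) := by
    refine (pr_biUnion p _ _).trans (Finset.sum_le_sum (fun j _ => ?_))
    set u := min (j * h0) h
    have hu : u ≤ h := min_le_right _ _
    have q1 := pr_union p (G 0 u 0 b ∪ G u h (-(2 * b)) (-b)) (Cr m h0 u ∪ reix mir (Cr m h0 u))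
    have q2 := pr_union p (G 0 u 0 b) (G u h (-(2 * b)) (-b))
    have q3 := pr_union p (Cr m h0 u) (reix mir (Cr m h0 u))
    rw [pr_Cr, pr_Cr_mir] at q3
    have q4 := G_le p (Nat.zero_le u) 0 b
    have q5 := G_le p hu (-(2 * b)) (-b)
    have e5 : (-b - -(2 * b) : ℤ) = b := by ring
    rw [sub_zero, Nat.sub_zero] at q4
    rw [e5] at q5
    have q6 := hb u hu
    have q7 := hb (h - u) (by omega)
    linarith
  rw [Finset.sum_const, Finset.card_range, nsmul_eq_mul] at hsum
  push_cast at hsum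
  have hA : ((K:ℝ) + 1) * (2 * (1 / (K:ℝ)^4)) ≤ 1/8 := by
    have : ((K:ℝ) + 1) * (2 * (1 / (K:ℝ)^4)) = (2 * (K + 1)) / K^4 := by ring
    rw [this, div_le_iff₀ (by positivity)]
    nlinarith [sq_nonneg (K:ℝ)]
  have hB : 1/2 ≤ ((K:ℝ) + 1) * (2 * Hr p m h0) := by
    have e : ((K:ℝ) + 1) * (2 * (1 / (K:ℝ)^4) + 2 * Hr p m h0) =
      ((K:ℝ) + 1) * (2 * (1 / (K:ℝ)^4)) + ((K:ℝ) + 1) * (2 * Hr p m h0) := by ring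
    rw [e] at hsum
    linarith
  rw [div_le_iff₀ (by positivity)]
  have hHn : 0 ≤ Hr p m h0 := pr_nonneg _ _
  have : (4 * ((K:ℝ) + 1)) ≤ K^2 := by nlinarith
  nlinarith

lemma no_cross {p : ℝ} (hp : p ∈ Set.Icc (0:ℝ) 1) {K b T w : ℕ} (hK : 5 ≤ K) (hbw : 2 * b ≤ w) (hw : 2 ≤ w)
    (hE : ∀ h ≤ T, 7/8 ≤ F p h (-b)) (hb : ∀ u ≤ T, F p u b ≤ 1 / (K:ℝ)^4) (i h : ℕ) (h1 : 1 ≤ h)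
    (hi : h ≤ K ^ i) (hT : h ≤ T) : Hr p (20 ^ i * w) h < 1 / (K:ℝ)^2 := by
  have hK' : (5:ℝ) ≤ K := by exact_mod_cast hK
  induction i generalizing h with
  | zero =>
    rw [pow_zero] at hi
    rw [Hr_one p (by omega)]
    positivity
  | succ i ih =>
    by_contra hlt
    push Not at hlt
    have hK0 : 0 < K := by omega
    set h0 := (h + K - 1) / K
    have e1 : h ≤ K * h0 := by
      have h2 : h + K - 1 < K * ((h + K - 1) / K) + K := by
        have := Nat.div_add_mod (h + K - 1) K
        have := Nat.mod_lt (h + K - 1) hK0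
        omega
      change h ≤ K * ((h + K - 1) / K)
      omega
    have e2 : 1 ≤ h0 := by rw [Nat.le_div_iff_mul_le hK0]; omega
    have e3 : h0 ≤ K ^ i := by
      have : h0 < K ^ i + 1 := by
        rw [Nat.div_lt_iff_lt_mul hK0]
        rw [pow_succ] at hi
        rw [add_mul]
        omega
      omega
    have e4 : h0 ≤ h := by
      have : h0 < h + 1 := by
        rw [Nat.div_lt_iff_lt_mul hK0]
        have : h + K ≤ h * K + K := by
          have := Nat.le_mul_of_pos_right h hK0
          omega
        rw [add_mul]
        omega
      omega
    have h20 : 1 ≤ 20 ^ i := Nat.one_le_pow _ _ (by norm_num)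
    have h3 := descent hp (m := 20 ^ i * w) hK e2 e1 (by nlinarith) (hE h hT) (fun u hu => hb u (hu.trans hT))
      (by rw [← mul_assoc, ← pow_succ']; exact hlt)
    exact absurd h3 (not_le.2 (ih h0 e2 e3 (e4.trans hT)))

/-! ### The main estimate -/

/-- the consequence of criticality used below -/
def Crit (p : ℝ) : Prop := ∀ n M : ℕ, (M:ℝ) ≤ ∑ k ∈ Finset.range (M + n), F p n (-M + 1 + k)

lemma Crit.lower {p : ℝ} (hc : Crit p) (h b : ℕ) :
    (b + 1 : ℝ) - ∑ k ∈ Finset.range h, F p h (k + 1) ≤ (b + 1) * F p h (-b) := by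
  have h1 := hc h (b + 1)
  rw [Finset.sum_range_add] at h1
  have h2 : ∑ k ∈ Finset.range (b + 1), F p h (-(b + 1 : ℕ) + 1 + k) ≤ ∑ k ∈ Finset.range (b + 1), F p h (-b) :=
    Finset.sum_le_sum (fun k _ => F_anti p h (by push_cast; omega))
  have h3 : ∑ k ∈ Finset.range h, F p h (-(b + 1 : ℕ) + 1 + (b + 1 + k : ℕ)) = ∑ k ∈ Finset.range h, F p h (k + 1) := by
    apply Finset.sum_congr rfl
    intro k _
    congr 1
    push_cast
    ring
  rw [h3] at h1
  rw [Finset.sum_const, Finset.card_range, nsmul_eq_mul] at h2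
  push_cast at h1 h2
  linarith

lemma sum_ite_le (h R : ℕ) {c : ℝ} (hc : 0 ≤ c) :
    ∑ k ∈ Finset.range h, (if k + 1 ≤ R then c else 0) ≤ R * c := by
  rw [← Finset.sum_filter, Finset.sum_const, nsmul_eq_mul]
  apply mul_le_mul_of_nonneg_right _ hc
  have : (Finset.filter (fun k => k + 1 ≤ R) (Finset.range h)).card ≤ (Finset.range R).card := by
    apply Finset.card_le_card
    intro k hk
    have := (Finset.mem_filter.1 hk).2
    rw [Finset.mem_range]; omega
  rw [Finset.card_range] at this
  exact_mod_cast this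

lemma sumU {p : ℝ} {K T R Q h : ℕ} (hh : h ≤ T) (hR : ∀ m ≤ T, ∀ y : ℤ, R < y → F p m y ≤ 1 / (K:ℝ)^4)
    (hQ : ∀ m ≤ T, ∀ y : ℤ, Q ≤ y → F p m y ≤ (1/2)^K) (hT : (T:ℝ) ≤ 2^K) :
    ∑ k ∈ Finset.range h, F p h (k + 1) ≤ R + Q / (K:ℝ)^4 + 1 := by
  have key : ∀ k ∈ Finset.range h, F p h (k + 1) ≤ (if k + 1 ≤ R then (1:ℝ) else 0) +
      (if k + 1 ≤ Q then 1 / (K:ℝ)^4 else 0) + (1/2)^K := by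
    intro k _
    have q1 : (0:ℝ) ≤ 1 / (K:ℝ)^4 := by positivity
    have q2 : (0:ℝ) ≤ (1/2)^K := by positivity
    by_cases h1 : k + 1 ≤ R
    · rw [if_pos h1]
      have := F_le_one p h (k + 1)
      split_ifs <;> linarith
    · rw [if_neg h1]
      by_cases h2 : k + 1 ≤ Q
      · rw [if_pos h2]
        have := hR h hh (k + 1) (by omega)
        linarith
      · rw [if_neg h2]
        have := hQ h hh (k + 1) (by omega)
        linarith
  have h1 := Finset.sum_le_sum key
  rw [Finset.sum_add_distrib, Finset.sum_add_distrib, Finset.sum_const, Finset.card_range, nsmul_eq_mul] at h1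
  have h2 := sum_ite_le h R zero_le_one
  have h3 := sum_ite_le h Q (c := 1 / (K:ℝ)^4) (by positivity)
  have h4 : (h:ℝ) * (1/2)^K ≤ 1 := by
    rw [one_div, inv_pow, ← div_eq_mul_inv, div_le_one (by positivity)]
    have : (h:ℝ) ≤ T := by exact_mod_cast hh
    linarith
  have h5 : (Q:ℝ) * (1 / (K:ℝ)^4) = Q / K^4 := by ring
  rw [h5] at h3
  linarith

/-- Claim A: the width of crossed columns is not much larger than the displacement scale. -/
lemma claimA {p : ℝ} (hp : p ∈ Set.Icc (0:ℝ) 1) (hc : Crit p) {K L T R k : ℕ} (hK : 16 ≤ K) (hKL : 4 * 20 ^ L ≤ K)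
    (hT1 : 1 ≤ T) (hTL : T ≤ K ^ L) (hT : (T:ℝ) ≤ 2^K)
    (hR : ∀ m ≤ T, ∀ y : ℤ, R < y → F p m y ≤ 1 / (K:ℝ)^4)
    (hk1 : Hr p (2 * (k + 1)) T ≤ 1/2) (hk2 : 1/2 ≤ Hr p (2 * k) T) :
    2 * (k + 1) < K^2 * (R + 1) := by
  by_contra hlt
  push Not at hlt
  set w := 2 * (k + 1) with hw
  have hQ : ∀ m ≤ T, ∀ y : ℤ, ((K * w : ℕ) : ℤ) ≤ y → F p m y ≤ (1/2)^K := by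
    intro m hm y hy
    push_cast at hy
    refine (F_le_pow p (w := w) (k := K) ⟨k+1, by omega⟩ hm hy).trans ?_
    exact pow_le_pow_left₀ (pr_nonneg _ _) hk1 K
  have hK0 : 0 < K := by omega
  set b := w / K
  have hb1 : b * K ≤ w := Nat.div_mul_le_self w K
  have hb2 : w < b * K + K := Nat.lt_div_mul_add hK0
  have hwr : (w:ℝ) < (b + 1) * K := by
    have : (w:ℝ) < b * K + K := by exact_mod_cast hb2
    linarith
  have hKr : (16:ℝ) ≤ K := by exact_mod_cast hK
  have hlt' : (K:ℝ)^2 * (R + 1) ≤ w := by exact_mod_cast hlt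
  have hRb : R < b := by
    have : K * (R + 1) ≤ b := by
      rw [Nat.le_div_iff_mul_le hK0]
      calc K * (R+1) * K = K^2 * (R+1) := by ring
        _ ≤ w := hlt
    nlinarith
  have hE : ∀ h ≤ T, 7/8 ≤ F p h (-b) := by
    intro h hh
    have h1 := hc.lower h b
    have h2 := sumU hh hR hQ hT
    have h3 : 8 * ((R:ℝ) + (K * w : ℕ) / (K:ℝ)^4 + 1) ≤ b + 1 := by
      push_cast
      have e1 : (K * w : ℝ) / K^4 ≤ w / K^2 := by
        rw [div_le_div_iff₀ (by positivity) (by positivity)]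
        have : (0:ℝ) ≤ w := Nat.cast_nonneg _
        have h6 : (K:ℝ)^3 * w ≤ K^4 * w := by
          apply mul_le_mul_of_nonneg_right _ this
          exact pow_le_pow_right₀ (by linarith) (by norm_num)
        nlinarith
      have e2 : (R:ℝ) + 1 ≤ w / K^2 := by
        rw [le_div_iff₀ (by positivity)]; linarith
      have e3 : 16 * ((w:ℝ) / K^2) ≤ w / K := by
        have : (w:ℝ) / K = K * (w / K^2) := by field_simp
        rw [this]
        apply mul_le_mul_of_nonneg_right hKr (by positivity)
      have e4 : (w:ℝ) / K < b + 1 := by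
        rw [div_lt_iff₀ (by positivity)]; exact hwr
      linarith
    have hb0 : (0:ℝ) < b + 1 := by positivity
    have h4 : (b + 1 : ℝ) * (7/8) ≤ (b + 1) * F p h (-b) := by linarith
    exact le_of_mul_le_mul_left h4 hb0
  have hb4 : ∀ u ≤ T, F p u b ≤ 1 / (K:ℝ)^4 := fun u hu => hR u hu b (by exact_mod_cast hRb)
  have h1 := no_cross hp (w := 2 * b) (by omega : 5 ≤ K) le_rfl (by omega) hE hb4 L T hT1 hTL le_rfl
  have h2 : 20 ^ L * (2 * b) ≤ 2 * k := by
    have hw2 : 4 ≤ w := by nlinarith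
    have : 4 * 20 ^ L * b ≤ w := by
      calc 4 * 20^L * b ≤ K * b := Nat.mul_le_mul_right _ hKL
        _ = b * K := mul_comm _ _
        _ ≤ w := hb1
    have e : 20 ^ L * (2 * b) = 2 * (20^L * b) := by ring
    have e' : 4 * 20 ^ L * b = 4 * (20^L * b) := by ring
    rw [e]; rw [e'] at this
    omega
  have h3 : Hr p (2 * k) T ≤ Hr p (20 ^ L * (2 * b)) T := pr_mono p (Hev_anti h2)
  have h4 : 1 / (K:ℝ)^2 ≤ 1/2 := by
    apply one_div_le_one_div_of_le (by norm_num)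
    nlinarith
  linarith

/-- start in `[0,κ]` and moving to the right in time `u` -/
def Rc (T u κ : ℕ) : Set Cf := Pe 0 T (fun v => 0 ≤ v 0 ∧ v 0 ≤ κ ∧ Even (v 0) ∧ v 0 ≤ v u)

lemma FD_Rc (T u κ : ℕ) : FD (Rc T u κ) := by
  apply FD_Pe κ
  rintro v ⟨h1, h2, _⟩ _
  rw [abs_le]; omega

lemma Rc_sh (p : ℝ) (T u κ : ℕ) {c : ℤ} (hc : Even c) :
    pr p (Pe 0 T (fun v => c ≤ v 0 ∧ v 0 ≤ c + κ ∧ Even (v 0) ∧ v 0 ≤ v u)) = pr p (Rc T u κ) := by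
  rw [← pr_reix p (sh_inj c 0) (FD_Rc T u κ), Rc, reix_sh]
  congr 1
  simp only [Nat.add_zero, Int.even_sub, hc, iff_true]
  congr 1
  ext v
  constructor
  · rintro ⟨h1, h2, h3, h4⟩
    exact ⟨by omega, by omega, h3, by omega⟩
  · rintro ⟨h1, h2, h3, h4⟩
    exact ⟨by omega, by omega, h3, by omega⟩

lemma Rc_mir (p : ℝ) (T u κ : ℕ) {c : ℤ} (hc : Even c) (hκ : Even (κ:ℤ)) :
    pr p (Pe 0 T (fun v => c ≤ v 0 ∧ v 0 ≤ c + κ ∧ Even (v 0) ∧ v u ≤ v 0)) = pr p (Rc T u κ) := by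
  have hc' : Even (-c - κ) := hc.neg.sub hκ
  rw [← Rc_sh p T u κ hc', ← pr_mir]
  · congr 1
    congr 1
    ext v
    simp only [even_neg]
    constructor
    · rintro ⟨h1, h2, h3, h4⟩
      exact ⟨by omega, by omega, h3, by omega⟩
    · rintro ⟨h1, h2, h3, h4⟩
      exact ⟨by omega, by omega, h3, by omega⟩
  · apply FD_Pe (|c| + κ)
    rintro v ⟨h1, h2, _⟩ _
    have := le_abs_self c
    have := neg_abs_le c
    rw [abs_le]; omega

lemma Rc_combine {p : ℝ} (hp : p ∈ Set.Icc (0:ℝ) 1) {T S κ R : ℕ} (hS : S ≤ T) (hκ : Even (κ:ℤ)) :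
    pr p (Rc T (T - S) κ) * F p S R ≤ F p T (R - 1 - κ) := by
  set a0 : ℤ := -(((T - S) % 2 : ℕ) : ℤ)
  have e0 : Even (a0 + (T - S : ℕ)) := by rw [Int.even_iff]; omega
  have h1 := G_eq p (Nat.sub_le T S) (a0 + R) e0
  have e1 : T - (T - S) = S := by omega
  rw [e1, add_sub_cancel_left] at h1
  have h2 := G_eq p (Nat.zero_le T) (R - 1) (x := κ) (by simpa using hκ)
  rw [Nat.sub_zero] at h2
  rw [← h1, ← h2]
  refine (harris hp (FD_Rc _ _ _) (FD_G (Nat.sub_le T S) _ _) (Pe_up _ _ _) (Pe_up _ _ _)).trans (pr_mono p ?_)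
  rintro ω ⟨⟨a, ⟨a1, a2, a3, a4⟩, a5, a6⟩, ⟨b, ⟨b1, b2, b3⟩, b4, b5⟩⟩
  by_cases hab : R - 1 ≤ a T
  · exact ⟨a, ⟨a2, by simpa using a3, hab⟩, a5, a6⟩
  have pa : Even (a (T - S) + (T - S : ℕ)) :=
    (a5.par le_rfl (Nat.zero_le _) (Nat.sub_le T S)).2 (by simpa using a3)
  obtain ⟨c, c1, c2, c3⟩ := meet b4 (a5.sub (Nat.zero_le _) le_rfl) (Nat.sub_le T S)
    (by rw [Int.even_iff] at *; omega) (by omega) (by omega)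
  refine ⟨spl c a b, ⟨?_, ?_, ?_⟩, spl_NN (a5.sub le_rfl c2) (b4.sub c1 le_rfl) c3.symm,
    spl_Op (a6.sub le_rfl c2) (b5.sub c1 le_rfl) c3.symm⟩
  · rw [spl_le (Nat.zero_le _)]; exact a2
  · rw [spl_le (Nat.zero_le _)]; simpa using a3
  · rw [spl_ge c3.symm c2]; omega

/-- Claim B: displacement of order `R` at time exactly `T`. -/
lemma claimB {p : ℝ} (hp : p ∈ Set.Icc (0:ℝ) 1) (hc : Crit p) {K T R Q S : ℕ} (hK : 16 ≤ K) (hT : (T:ℝ) ≤ 2^K)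
    (hR4 : 4 ≤ R) (hR : ∀ m ≤ T, ∀ y : ℤ, R < y → F p m y ≤ 1 / (K:ℝ)^4)
    (hQ : ∀ m ≤ T, ∀ y : ℤ, Q ≤ y → F p m y ≤ (1/2)^K) (hQR : Q ≤ K^3 * (R+1))
    (hS : S ≤ T) (hSR : 1 / (K:ℝ)^4 ≤ F p S R) :
    1 / (200 * (K:ℝ)^4) ≤ F p T ((R/4 : ℕ)) := by
  have hKr : (16:ℝ) ≤ K := by exact_mod_cast hK
  have hK4 : 1 / (K:ℝ)^4 ≤ 1/4 := by
    apply one_div_le_one_div_of_le (by norm_num)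
    have : (16:ℝ)^4 ≤ K^4 := pow_le_pow_left₀ (by norm_num) hKr 4
    linarith
  set b := 4 * (R + 1)
  -- a path which does not go far left
  have h1 : 1/2 ≤ F p T (-b) := by
    have q1 := hc.lower T b
    have q2 := sumU le_rfl hR hQ hT
    have q3 : (Q:ℝ) / (K:ℝ)^4 ≤ (R + 1)/16 := by
      have : (Q:ℝ) ≤ K^3 * (R+1) := by exact_mod_cast hQR
      rw [div_le_div_iff₀ (by positivity) (by norm_num)]
      calc (Q:ℝ) * 16 ≤ K^3 * (R+1) * K := mul_le_mul this hKr (by norm_num) (by positivity)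
        _ = (R + 1) * K^4 := by ring
    have hbr : (b:ℝ) = 4 * (R + 1) := by simp only [b]; push_cast; ring
    have hb0 : (0:ℝ) < b + 1 := by positivity
    have hRn : (0:ℝ) ≤ R := Nat.cast_nonneg _
    have h4 : (b + 1 : ℝ) * (1/2) ≤ (b + 1) * F p T (-b) := by linarith
    exact le_of_mul_le_mul_left h4 hb0
  obtain ⟨κ, hκ⟩ : ∃ κ, κ = 2 * (R / 4) := ⟨_, rfl⟩
  have hκe : Even (κ:ℤ) := by rw [Int.even_iff]; omega
  have hsub : G 0 T 0 (-b) ⊆ G 0 T (-(b + R + 1)) (-b) ∪ ⋃ i ∈ Finset.range 25,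
      (Pe 0 T (fun v => -(κ * (i + 1) : ℤ) ≤ v 0 ∧ v 0 ≤ -(κ * (i + 1) : ℤ) + κ ∧ Even (v 0) ∧ v 0 ≤ v (T - S)) ∪
       Pe 0 T (fun v => -(κ * (i + 1) : ℤ) ≤ v 0 ∧ v 0 ≤ -(κ * (i + 1) : ℤ) + κ ∧ Even (v 0) ∧ v (T - S) ≤ v 0)) := by
    rintro ω ⟨v, ⟨h1, h2, h3⟩, hn, ho⟩
    have h2' : Even (v 0) := by simpa using h2
    by_cases h0 : v 0 ≤ -(b + R + 1)
    · exact Or.inl ⟨v, ⟨h0, h2, h3⟩, hn, ho⟩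
    · right
      have hκ0 : 0 < κ := by omega
      set i := (-(v 0)).toNat / κ
      have hi1 : i * κ ≤ (-(v 0)).toNat := Nat.div_mul_le_self _ _
      have hi2 : (-(v 0)).toNat < i * κ + κ := Nat.lt_div_mul_add hκ0
      have hi3 : i < 25 := by
        rw [Nat.div_lt_iff_lt_mul hκ0]
        omega
      simp only [Set.mem_iUnion]
      refine ⟨i, Finset.mem_range.2 hi3, ?_⟩
      have e : (κ * (i + 1) : ℤ) = ((i * κ + κ : ℕ) : ℤ) := by push_cast; ring
      rw [e]
      rcases le_total (v 0) (v (T - S)) with h | h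
      · exact Or.inl ⟨v, ⟨by omega, by omega, h2', h⟩, hn, ho⟩
      · exact Or.inr ⟨v, ⟨by omega, by omega, h2', h⟩, hn, ho⟩
  have h2 := (h1.trans (pr_mono p hsub)).trans (pr_union _ _ _)
  have h3 := G_le p (Nat.zero_le T) (-(b + R + 1)) (-b)
  have h4 := hR T le_rfl (-b - -(b + R + 1)) (by omega)
  rw [Nat.sub_zero] at h3
  have h5 : pr p (⋃ i ∈ Finset.range 25,
      (Pe 0 T (fun v => -(κ * (i + 1) : ℤ) ≤ v 0 ∧ v 0 ≤ -(κ * (i + 1) : ℤ) + κ ∧ Even (v 0) ∧ v 0 ≤ v (T - S)) ∪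
       Pe 0 T (fun v => -(κ * (i + 1) : ℤ) ≤ v 0 ∧ v 0 ≤ -(κ * (i + 1) : ℤ) + κ ∧ Even (v 0) ∧ v (T - S) ≤ v 0)))
      ≤ ∑ i ∈ Finset.range 25, 2 * pr p (Rc T (T - S) κ) := by
    refine (pr_biUnion p _ _).trans (Finset.sum_le_sum (fun i _ => (pr_union _ _ _).trans ?_))
    have hce : Even (-(κ * (i + 1) : ℤ)) := (hκe.mul_right _).neg
    rw [Rc_sh p T (T - S) κ hce, Rc_mir p T (T - S) κ hce hκe]
    linarith
  rw [Finset.sum_const, Finset.card_range, nsmul_eq_mul] at h5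
  push_cast at h5
  have h6 : 1/200 ≤ pr p (Rc T (T - S) κ) := by linarith
  have h7 := Rc_combine hp hS hκe (R := R)
  have h8 : F p T (R - 1 - κ) ≤ F p T ((R/4 : ℕ)) := F_anti p T (by omega)
  refine le_trans ?_ (h7.trans h8)
  calc 1 / (200 * (K:ℝ)^4) = 1/200 * (1 / (K:ℝ)^4) := by ring
    _ ≤ _ := mul_le_mul h6 hSR (by positivity) (by linarith)

lemma ta_le_F (p : ℝ) (x : ℤ) (n : ℕ) : ta p x n ≤ F p n |x| := by
  rcases abs_cases x with ⟨h, _⟩ | ⟨h, _⟩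
  · rw [h]
    exact pr_mono p (Pe_mono (fun v _ ⟨a, b⟩ => ⟨by omega, by rw [a]; simp, by omega⟩))
  · rw [h]
    have := Gm_eq' p (Nat.zero_le n) x (x := 0) (by simp)
    rw [zero_sub, Nat.sub_zero] at this
    rw [← this]
    exact pr_mono p (Pe_mono (fun v _ ⟨a, b⟩ => ⟨by omega, by rw [a]; simp, by omega⟩))

/-- lower bound for the expected size -/
lemma ch_lower {p : ℝ} (hp : p ∈ Set.Icc (0:ℝ) 1) {n r : ℕ} (hr : r ≤ n) :
    r * (th p n ^ 2 * F p n r ^ 2) ≤ ch p n := by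
  set f : ℕ → ℤ := fun i => 2 * i - r + ((r + n) % 2 : ℕ)
  have hinj : Function.Injective f := by
    intro i j h
    simp only [f] at h
    omega
  have h1 : ∑ x ∈ (Finset.range r).image f, ta p x n ≤ ch p n := by
    apply Finset.sum_le_sum_of_subset_of_nonneg
    · intro x hx
      obtain ⟨i, hi, rfl⟩ := Finset.mem_image.1 hx
      rw [Finset.mem_range] at hi
      rw [Finset.mem_Icc]
      simp only [f]
      omega
    · intro x _ _
      exact ta_nonneg p x n
  rw [Finset.sum_image (fun a _ b _ h => hinj h)] at h1
  refine le_trans ?_ h1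
  have h2 : ∑ i ∈ Finset.range r, th p n ^ 2 * F p n r ^ 2 ≤ ∑ i ∈ Finset.range r, ta p (f i) n := by
    apply Finset.sum_le_sum
    intro i hi
    rw [Finset.mem_range] at hi
    refine le_trans ?_ (ta_lower hp (f i) n (by rw [Int.even_iff]; simp only [f]; omega))
    apply mul_le_mul_of_nonneg_left _ (sq_nonneg _)
    apply pow_le_pow_left₀ (F_nonneg _ _ _)
    apply F_anti
    rw [abs_le]
    simp only [f]
    omega
  rwa [Finset.sum_const, Finset.card_range, nsmul_eq_mul] at h2

lemma gy_upper {p : ℝ} (hp : p ∈ Set.Icc (0:ℝ) 1) (h0 : 0 < p) {T K Q : ℕ} (hQ1 : 1 ≤ Q) (hT1 : 1 ≤ T)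
    (hQ : ∀ m ≤ T, ∀ y : ℤ, Q ≤ y → F p m y ≤ (1/2)^K) (hch : 3 * (T:ℝ)^3 * (1/2)^K ≤ ch p T) :
    gy p T ≤ 2 * Q := by
  have hc := ch_pos hp h0 T
  have hQr : (1:ℝ) ≤ Q := by exact_mod_cast hQ1
  have hTr : (1:ℝ) ≤ T := by exact_mod_cast hT1
  have key : ∀ x ∈ Finset.Icc (-(T:ℤ)) T, (x:ℝ)^2 * ta p x T ≤ (Q:ℝ)^2 * ta p x T + (T:ℝ)^2 * (1/2)^K := by
    intro x hx
    rw [Finset.mem_Icc] at hx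
    have ht := ta_nonneg p x T
    by_cases h : (Q:ℤ) ≤ |x|
    · have h1 := (ta_le_F p x T).trans (hQ T le_rfl _ h)
      have h2 : (x:ℝ)^2 ≤ (T:ℝ)^2 := by
        have : |x| ≤ T := abs_le.2 hx
        have : |(x:ℝ)| ≤ T := by exact_mod_cast this
        rw [← sq_abs]
        exact pow_le_pow_left₀ (abs_nonneg _) this 2
      have h3 : (x:ℝ)^2 * ta p x T ≤ (T:ℝ)^2 * (1/2)^K := mul_le_mul h2 h1 ht (by positivity)
      have : 0 ≤ (Q:ℝ)^2 * ta p x T := by positivity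
      linarith
    · have h2 : (x:ℝ)^2 ≤ (Q:ℝ)^2 := by
        have : |x| ≤ Q := by omega
        have : |(x:ℝ)| ≤ Q := by exact_mod_cast this
        rw [← sq_abs]
        exact pow_le_pow_left₀ (abs_nonneg _) this 2
      have h3 : (x:ℝ)^2 * ta p x T ≤ (Q:ℝ)^2 * ta p x T := mul_le_mul_of_nonneg_right h2 ht
      have : 0 ≤ (T:ℝ)^2 * (1/2)^K := by positivity
      linarith
  have h1 : sm p T ≤ (Q:ℝ)^2 * ch p T + (2 * T + 1) * ((T:ℝ)^2 * (1/2)^K) := by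
    refine (Finset.sum_le_sum key).trans ?_
    rw [Finset.sum_add_distrib, ← Finset.mul_sum, Finset.sum_const, Int.card_Icc, nsmul_eq_mul]
    have : ((((T:ℤ) + 1 - -(T:ℤ)).toNat : ℕ) : ℝ) = 2 * T + 1 := by
      have : ((T:ℤ) + 1 - -(T:ℤ)).toNat = 2 * T + 1 := by omega
      rw [this]; push_cast; ring
    rw [this]
    exact le_rfl
  have h2 : (2 * T + 1) * ((T:ℝ)^2 * (1/2)^K) ≤ ch p T := by
    refine le_trans ?_ hch
    have : (2 * T + 1) * (T:ℝ)^2 ≤ 3 * (T:ℝ)^3 := by nlinarith [sq_nonneg (T:ℝ)]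
    rw [← mul_assoc]
    exact mul_le_mul_of_nonneg_right this (by positivity)
  apply Real.sqrt_le_iff.2
  refine ⟨by positivity, ?_⟩
  rw [div_le_iff₀ hc]
  have h3 : (1:ℝ) * ch p T ≤ (Q:ℝ)^2 * ch p T := mul_le_mul_of_nonneg_right (by nlinarith) hc.le
  have h4 : (2 * (Q:ℝ))^2 * ch p T = 4 * ((Q:ℝ)^2 * ch p T) := by ring
  rw [h4]; linarith

lemma main_est {p : ℝ} (hp : p ∈ Set.Icc (1/2:ℝ) 1) (hc : Crit p) {K L T : ℕ} (hK : 1280000 ≤ K)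
    (hKL : 4 * 20 ^ L ≤ K) (hT4 : 4 ≤ T) (hTL : T ≤ K ^ L) (hT : (T:ℝ) ≤ 2^K)
    (hch : 3 * (T:ℝ)^3 * (1/2)^K ≤ ch p T) :
    th p T ^ 2 * gy p T ≤ (K:ℝ)^12 * ch p T := by
  have hp' : p ∈ Set.Icc (0:ℝ) 1 := ⟨by linarith [hp.1], hp.2⟩
  have hp0 : 0 < p := by linarith [hp.1]
  have hKr : (1280000:ℝ) ≤ K := by exact_mod_cast hK
  set P : ℕ → Prop := fun y => ∃ m ≤ T, 1 / (K:ℝ)^4 ≤ F p m y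
  obtain ⟨R, hRdef⟩ : ∃ R, R = Nat.findGreatest P T := ⟨_, rfl⟩
  have hP4 : P 4 := by
    refine ⟨4, hT4, le_trans ?_ (F_diag hp' 4)⟩
    have h1 : (1/2:ℝ)^4 ≤ p^4 := pow_le_pow_left₀ (by norm_num) hp.1 4
    refine le_trans ?_ h1
    have : 1 / (K:ℝ)^4 = (1/(K:ℝ))^4 := by ring
    rw [this]
    apply pow_le_pow_left₀ (by positivity)
    apply one_div_le_one_div_of_le (by norm_num)
    linarith
  have hR4 : 4 ≤ R := by rw [hRdef]; exact Nat.le_findGreatest hT4 hP4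
  have hRT : R ≤ T := by rw [hRdef]; exact Nat.findGreatest_le T
  have hPR : P R := by rw [hRdef]; exact Nat.findGreatest_spec hT4 hP4
  obtain ⟨S, hS, hSR⟩ := hPR
  have hR : ∀ m ≤ T, ∀ y : ℤ, R < y → F p m y ≤ 1 / (K:ℝ)^4 := by
    intro m hm y hy
    by_cases hyT : y ≤ T
    · have h1 : Nat.findGreatest P T < y.toNat := by rw [← hRdef]; omega
      have h2 := Nat.findGreatest_is_greatest h1 (by omega)
      by_contra hx
      push Not at hx
      apply h2
      refine ⟨m, hm, ?_⟩
      have : ((y.toNat : ℕ) : ℤ) = y := by omega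
      rw [this]
      exact hx.le
    · rw [F_zero_of_gt p (by omega)]
      positivity
  have hex : ∃ k, Hr p (2 * k) T < 1/2 := ⟨T + 1, by rw [Hr_one p (by omega)]; norm_num⟩
  obtain ⟨k, hk1, hk2⟩ : ∃ k, Hr p (2 * (k + 1)) T < 1/2 ∧ 1/2 ≤ Hr p (2 * k) T := by
    have h1 := Nat.find_spec hex
    have h0 : Nat.find hex ≠ 0 := by
      intro h
      rw [h, mul_zero, Hr_zero] at h1
      norm_num at h1
    obtain ⟨k, hk⟩ := Nat.exists_eq_succ_of_ne_zero h0
    refine ⟨k, ?_, ?_⟩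
    · rw [hk] at h1; exact h1
    · have := Nat.find_min hex (m := k) (by omega)
      push Not at this
      exact this
  have hA := claimA hp' hc (by omega : 16 ≤ K) hKL (by omega) hTL hT hR hk1.le hk2
  obtain ⟨Q, hQdef⟩ : ∃ Q, Q = K * (2 * (k + 1)) := ⟨_, rfl⟩
  have hQ : ∀ m ≤ T, ∀ y : ℤ, (Q:ℤ) ≤ y → F p m y ≤ (1/2)^K := by
    intro m hm y hy
    rw [hQdef] at hy
    push_cast at hy
    refine (F_le_pow p (w := 2 * (k+1)) (k := K) ⟨k+1, by omega⟩ hm (by push_cast; exact hy)).trans ?_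
    exact pow_le_pow_left₀ (pr_nonneg _ _) hk1.le K
  have hQR : Q ≤ K^3 * (R + 1) := by
    calc Q = K * (2 * (k + 1)) := hQdef
      _ ≤ K * (K^2 * (R+1)) := Nat.mul_le_mul_left _ hA.le
      _ = K^3 * (R+1) := by ring
  have hQ1 : 1 ≤ Q := by
    rw [hQdef]
    have : 1 * 1 ≤ K * (2 * (k+1)) := Nat.mul_le_mul (by omega) (by omega)
    omega
  have hB := claimB hp' hc (by omega : 16 ≤ K) hT hR4 hR hQ hQR hS hSR
  have hg := gy_upper hp' hp0 hQ1 (by omega : 1 ≤ T) hQ hch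
  have hl := ch_lower hp' (n := T) (r := R / 4) (by omega)
  have hr : (R + 1 : ℝ) ≤ 8 * ((R / 4 : ℕ) : ℝ) := by
    have : R + 1 ≤ 8 * (R / 4) := by omega
    exact_mod_cast this
  set r : ℝ := ((R / 4 : ℕ) : ℝ)
  have hQr : (Q:ℝ) ≤ K^3 * (R + 1) := by exact_mod_cast hQR
  have ht := sq_nonneg (th p T)
  have hr0 : (0:ℝ) ≤ r := Nat.cast_nonneg _
  have hK3 : (0:ℝ) < (K:ℝ)^3 := by positivity
  have hg2 : gy p T ≤ 16 * K^3 * r := by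
    have : (K:ℝ)^3 * (R + 1) ≤ K^3 * (8 * r) := mul_le_mul_of_nonneg_left hr hK3.le
    linarith
  have hB2 : (1 / (200 * (K:ℝ)^4))^2 ≤ F p T ((R/4 : ℕ)) ^ 2 := pow_le_pow_left₀ (by positivity) hB 2
  have hl2 : r * (th p T ^ 2 * (1 / (200 * (K:ℝ)^4))^2) ≤ ch p T := by
    refine le_trans ?_ hl
    gcongr
  have e : (K:ℝ)^12 * (r * (th p T ^ 2 * (1 / (200 * (K:ℝ)^4))^2)) = th p T ^ 2 * (K^4 * r / 40000) := by
    field_simp; ring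
  calc th p T ^ 2 * gy p T ≤ th p T ^ 2 * (16 * K^3 * r) := mul_le_mul_of_nonneg_left hg2 ht
    _ ≤ th p T ^ 2 * (K^4 * r / 40000) := by
        apply mul_le_mul_of_nonneg_left _ ht
        have : (K:ℝ)^4 * r / 40000 = K^3 * r * (K / 40000) := by ring
        rw [this]
        have h16 : (16:ℝ) ≤ K / 40000 := by rw [le_div_iff₀ (by norm_num)]; linarith
        have : 0 ≤ (K:ℝ)^3 * r := by positivity
        nlinarith
    _ = _ := e.symm
    _ ≤ _ := mul_le_mul_of_nonneg_left hl2 (by positivity)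

lemma pow_le_two_pow_ev (m : ℕ) : ∀ᶠ K : ℕ in atTop, 3 * (K:ℝ)^m ≤ 2^K := by
  have h := tendsto_pow_const_div_const_pow_of_one_lt m (r := (2:ℝ)) (by norm_num)
  have h1 := h.eventually (gt_mem_nhds (show (0:ℝ) < 1/3 by norm_num))
  filter_upwards [h1] with K hK
  rw [div_lt_iff₀ (by positivity)] at hK
  linarith

lemma log_tend : Tendsto (fun n : ℕ => Real.log n) atTop atTop :=
  Real.tendsto_log_atTop.comp tendsto_natCast_atTop_atTop

lemma lower_log (D : ℕ) (hD : ∀ᶠ n : ℕ in atTop, -(D:ℝ) * Real.log n ≤ Real.log (ch (pc 1) n))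
    {ε : ℝ} (hε : 0 < ε) : ∀ᶠ n : ℕ in atTop,
      2 * Real.log (th (pc 1) n) + Real.log (gy (pc 1) n) - ε * Real.log n
        ≤ Real.log (ch (pc 1) n) := by
  have hpp := pc_mem
  have hp' : pc 1 ∈ Set.Icc (0:ℝ) 1 := ⟨by linarith [hpp.1], hpp.2⟩
  have hp0 : 0 < pc 1 := by linarith [hpp.1]
  obtain ⟨L, hL⟩ := exists_nat_gt (13 / ε)
  have hL0 : (0:ℝ) < L := lt_of_le_of_lt (by positivity) hL
  have hLn : L ≠ 0 := by rintro rfl; simp at hL0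
  have hLε : 13 / (L:ℝ) ≤ ε := by
    rw [div_lt_iff₀ hε] at hL
    rw [div_le_iff₀ hL0]; linarith
  set K : ℕ → ℕ := fun n => ⌈(n:ℝ) ^ (1/(L:ℝ))⌉₊ with hKdef
  have hKt : Tendsto K atTop atTop := by
    apply tendsto_nat_ceil_atTop.comp
    exact (tendsto_rpow_atTop (by positivity)).comp tendsto_natCast_atTop_atTop
  have e1 := hKt.eventually (eventually_ge_atTop 1280000)
  have e2 := hKt.eventually (eventually_ge_atTop (4 * 20 ^ L))
  have e3 := hKt.eventually (pow_le_two_pow_ev L)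
  have e4 := hKt.eventually (pow_le_two_pow_ev (L * (3 + D)))
  have e5 := log_tend.eventually (eventually_ge_atTop (12 * Real.log 2 * L))
  filter_upwards [e1, e2, e3, e4, e5, hD, eventually_ge_atTop 4] with n h1 h2 h3 h4 h5 h6 h7
  have hn : (4:ℝ) ≤ n := by exact_mod_cast h7
  have hn0 : (0:ℝ) < n := by linarith
  have hcp := ch_pos hp' hp0 n
  have htp := th_pos hp' hp0 n
  have hgp : 0 < gy (pc 1) n := by linarith [gy_lower hp' hp0 (show 1 ≤ n by omega)]
  have hKr : (1280000:ℝ) ≤ K n := by exact_mod_cast h1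
  have hroot : ((n:ℝ) ^ (1/(L:ℝ))) ^ L = n := by
    rw [← Real.rpow_natCast, ← Real.rpow_mul hn0.le, one_div, inv_mul_cancel₀ hL0.ne', Real.rpow_one]
  have hnK : (n:ℝ) ≤ (K n : ℝ) ^ L := by
    rw [← hroot]
    exact pow_le_pow_left₀ (by positivity) (Nat.le_ceil _) L
  have hnK' : n ≤ K n ^ L := by exact_mod_cast hnK
  have hn2 : (n:ℝ) ≤ 2 ^ (K n) := by
    have : 0 ≤ (K n : ℝ)^L := by positivity
    linarith
  have hchn : 1 / (n:ℝ)^D ≤ ch (pc 1) n := by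
    rw [← Real.log_le_log_iff (by positivity) hcp]
    rw [one_div, Real.log_inv, Real.log_pow]
    linarith
  have hch : 3 * (n:ℝ)^3 * (1/2)^(K n) ≤ ch (pc 1) n := by
    refine le_trans ?_ hchn
    rw [le_div_iff₀ (by positivity), one_div_pow, mul_one_div, div_mul_eq_mul_div,
      div_le_one (by positivity)]
    refine le_trans ?_ h4
    rw [pow_mul, mul_assoc, ← pow_add]
    apply mul_le_mul_of_nonneg_left _ (by norm_num)
    exact pow_le_pow_left₀ hn0.le hnK _
  have hm := main_est hpp F1 h1 h2 h7 hnK' hn2 hch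
  have hl := Real.log_le_log (by positivity) hm
  rw [Real.log_mul (by positivity) hgp.ne', Real.log_mul (by positivity) hcp.ne', Real.log_pow,
    Real.log_pow] at hl
  have hKup : (K n : ℝ) ≤ 2 * (n:ℝ) ^ (1/(L:ℝ)) := by
    have hb := Nat.ceil_lt_add_one (show (0:ℝ) ≤ (n:ℝ) ^ (1/(L:ℝ)) by positivity)
    have : (1:ℝ) ≤ (n:ℝ) ^ (1/(L:ℝ)) := Real.one_le_rpow (by linarith) (by positivity)
    simp only [hKdef]
    linarith
  have hlK : Real.log (K n) ≤ Real.log 2 + 1 / L * Real.log n := by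
    have := Real.log_le_log (by linarith) hKup
    rwa [Real.log_mul (by norm_num) (by positivity), Real.log_rpow hn0] at this
  have h8 : 12 * Real.log 2 ≤ 1 / L * Real.log n := by
    rw [one_div, inv_mul_eq_div, le_div_iff₀ hL0]; exact h5
  have hln : 0 ≤ Real.log n := Real.log_nonneg (by linarith)
  have h9 : 13 / (L:ℝ) * Real.log n ≤ ε * Real.log n := mul_le_mul_of_nonneg_right hLε hln
  have h10 : 13 / (L:ℝ) * Real.log n = 13 * (1 / L * Real.log n) := by ring
  push_cast at hl
  linarith

lemma upper_log {n : ℕ} (hn : 1 ≤ n) : Real.log (ch (pc 1) n) ≤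
    Real.log 8 + Real.log (gy (pc 1) n) + 2 * Real.log (th (pc 1) (n / 2)) := by
  have hpp := pc_mem
  have hp' : pc 1 ∈ Set.Icc (0:ℝ) 1 := ⟨by linarith [hpp.1], hpp.2⟩
  have hp0 : 0 < pc 1 := by linarith [hpp.1]
  have hcp := ch_pos hp' hp0 n
  have htp := th_pos hp' hp0 (n / 2)
  have hgp : 0 < gy (pc 1) n := by linarith [gy_lower hp' hp0 hn]
  have h := Real.log_le_log hcp (ch_upper hp' hp0 hn)
  rw [Real.log_mul (by positivity) (by positivity), Real.log_mul (by norm_num) hgp.ne',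
    Real.log_pow] at h
  push_cast at h
  exact h

lemma squeeze_eps {f u v : ℕ → ℝ} {l : ℝ} (hu : Tendsto u atTop (𝓝 l)) (hv : Tendsto v atTop (𝓝 l))
    (h1 : ∀ ε > 0, ∀ᶠ n in atTop, u n - ε ≤ f n) (h2 : ∀ ε > 0, ∀ᶠ n in atTop, f n ≤ v n + ε) :
    Tendsto f atTop (𝓝 l) := by
  rw [tendsto_order]
  constructor
  · intro a ha
    have hb : (a + l) / 2 < l := by linarith
    filter_upwards [h1 ((l - a)/2) (by linarith), hu.eventually (lt_mem_nhds hb)] with n h3 h4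
    linarith
  · intro a ha
    have hb : l < (a + l) / 2 := by linarith
    filter_upwards [h2 ((a - l)/2) (by linarith), hv.eventually (gt_mem_nhds hb)] with n h3 h4
    linarith

lemma log_const_div (c : ℝ) : Tendsto (fun n : ℕ => c / Real.log n) atTop (𝓝 0) :=
  tendsto_const_nhds.div_atTop log_tend

lemma ratio_double : Tendsto (fun n : ℕ => Real.log ((2 * n : ℕ) : ℝ) / Real.log n) atTop (𝓝 1) := by
  have h := (log_const_div (Real.log 2)).add_const 1
  rw [zero_add] at h
  refine h.congr' ?_
  filter_upwards [eventually_ge_atTop 2] with n hn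
  have hn' : (2:ℝ) ≤ n := by exact_mod_cast hn
  have hl : 0 < Real.log n := Real.log_pos (by linarith)
  push_cast
  rw [Real.log_mul (by norm_num) (by positivity)]
  field_simp

lemma ratio_half : Tendsto (fun n : ℕ => Real.log ((n / 2 : ℕ) : ℝ) / Real.log n) atTop (𝓝 1) := by
  have h := (log_const_div (-Real.log 4)).add_const 1
  rw [zero_add] at h
  refine tendsto_of_tendsto_of_tendsto_of_le_of_le' h tendsto_const_nhds ?_ ?_
  · filter_upwards [eventually_ge_atTop 2] with n hn
    have hn' : (2:ℝ) ≤ n := by exact_mod_cast hn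
    have hl : 0 < Real.log n := Real.log_pos (by linarith)
    have h4 : (n:ℝ) ≤ 4 * ((n / 2 : ℕ) : ℝ) := by
      have : n ≤ 4 * (n / 2) := by omega
      exact_mod_cast this
    have hh : (0:ℝ) < ((n / 2 : ℕ) : ℝ) := by linarith
    have := Real.log_le_log (by linarith) h4
    rw [Real.log_mul (by norm_num) hh.ne'] at this
    rw [div_add_one hl.ne']
    apply div_le_div_of_nonneg_right _ hl.le
    linarith
  · filter_upwards [eventually_ge_atTop 2] with n hn
    have hn' : (2:ℝ) ≤ n := by exact_mod_cast hn
    have hl : 0 < Real.log n := Real.log_pos (by linarith)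
    rw [div_le_one hl]
    apply Real.log_le_log
    · have : 0 < n / 2 := by omega
      exact_mod_cast this
    · exact_mod_cast Nat.div_le_self n 2

lemma half_tend : Tendsto (fun n : ℕ => n / 2) atTop atTop :=
  Nat.tendsto_div_const_atTop (by norm_num)

lemma dbl_tend : Tendsto (fun n : ℕ => 2 * n) atTop atTop :=
  tendsto_id.const_mul_atTop' (by norm_num)

lemma poly_of_rho {ρ : ℝ}
    (h : Tendsto (fun t : ℕ => -Real.log (th (pc 1) t) / Real.log t) atTop (𝓝 ρ)) :
    ∃ D : ℕ, ∀ᶠ n : ℕ in atTop, -(D:ℝ) * Real.log n ≤ Real.log (ch (pc 1) n) := by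
  have hpp := pc_mem
  have hp' : pc 1 ∈ Set.Icc (0:ℝ) 1 := ⟨by linarith [hpp.1], hpp.2⟩
  have hp0 : 0 < pc 1 := by linarith [hpp.1]
  obtain ⟨D, hD⟩ := exists_nat_gt ρ
  refine ⟨D, ?_⟩
  filter_upwards [h.eventually (gt_mem_nhds hD), eventually_ge_atTop 2] with n h1 hn
  have hn' : (2:ℝ) ≤ n := by exact_mod_cast hn
  have hl : 0 < Real.log n := Real.log_pos (by linarith)
  rw [div_lt_iff₀ hl] at h1
  have := Real.log_le_log (th_pos hp' hp0 n) (th_le_ch (pc 1) n)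
  linarith

lemma poly_of_eta {η : ℝ}
    (h : Tendsto (fun t : ℕ => Real.log (ch (pc 1) t) / Real.log t) atTop (𝓝 η)) :
    ∃ D : ℕ, ∀ᶠ n : ℕ in atTop, -(D:ℝ) * Real.log n ≤ Real.log (ch (pc 1) n) := by
  obtain ⟨D, hD⟩ := exists_nat_gt (-η)
  refine ⟨D, ?_⟩
  filter_upwards [h.eventually (lt_mem_nhds (show -(D:ℝ) < η by linarith)),
    eventually_ge_atTop 2] with n h1 hn
  have hn' : (2:ℝ) ≤ n := by exact_mod_cast hn
  have hl : 0 < Real.log n := Real.log_pos (by linarith)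
  rw [lt_div_iff₀ hl] at h1
  linarith

lemma lower_ratio (h : ∃ D : ℕ, ∀ᶠ n : ℕ in atTop, -(D:ℝ) * Real.log n ≤ Real.log (ch (pc 1) n))
    {ε : ℝ} (hε : 0 < ε) : ∀ᶠ n : ℕ in atTop,
      Real.log (gy (pc 1) n) / Real.log n - 2 * (-Real.log (th (pc 1) n) / Real.log n) - ε
        ≤ Real.log (ch (pc 1) n) / Real.log n := by
  obtain ⟨D, hD⟩ := h
  filter_upwards [lower_log D hD hε, eventually_ge_atTop 2] with n h1 hn
  have hn' : (2:ℝ) ≤ n := by exact_mod_cast hn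
  have hl : 0 < Real.log n := Real.log_pos (by linarith)
  rw [le_div_iff₀ hl]
  have : (Real.log (gy (pc 1) n) / Real.log n - 2 * (-Real.log (th (pc 1) n) / Real.log n) - ε)
    * Real.log n = 2 * Real.log (th (pc 1) n) + Real.log (gy (pc 1) n) - ε * Real.log n := by
    field_simp
    ring
  rw [this]; exact h1

lemma upper_ratio : ∀ᶠ n : ℕ in atTop, Real.log (ch (pc 1) n) / Real.log n ≤
      Real.log 8 / Real.log n + Real.log (gy (pc 1) n) / Real.log n
        - 2 * ((-Real.log (th (pc 1) (n / 2)) / Real.log ((n / 2 : ℕ) : ℝ)) *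
          (Real.log ((n / 2 : ℕ) : ℝ) / Real.log n)) := by
  filter_upwards [eventually_ge_atTop 4] with n hn
  have hn' : (4:ℝ) ≤ n := by exact_mod_cast hn
  have hl : 0 < Real.log n := Real.log_pos (by linarith)
  have hh : (2:ℝ) ≤ ((n / 2 : ℕ) : ℝ) := by
    have : 2 ≤ n / 2 := by omega
    exact_mod_cast this
  have hl2 : 0 < Real.log ((n / 2 : ℕ) : ℝ) := Real.log_pos (by linarith)
  rw [div_mul_div_cancel₀ hl2.ne', div_le_iff₀ hl]
  have : (Real.log 8 / Real.log n + Real.log (gy (pc 1) n) / Real.log n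
      - 2 * (-Real.log (th (pc 1) (n / 2)) / Real.log n)) * Real.log n =
      Real.log 8 + Real.log (gy (pc 1) n) + 2 * Real.log (th (pc 1) (n / 2)) := by
    field_simp
    ring
  rw [this]
  exact upper_log (by omega)

lemma upper_ratio2 : ∀ᶠ n : ℕ in atTop, -Real.log (th (pc 1) n) / Real.log n ≤
      (Real.log 8 / Real.log n + (Real.log (gy (pc 1) (2 * n)) / Real.log ((2 * n : ℕ) : ℝ)
        - Real.log (ch (pc 1) (2 * n)) / Real.log ((2 * n : ℕ) : ℝ)) *
          (Real.log ((2 * n : ℕ) : ℝ) / Real.log n)) / 2 := by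
  filter_upwards [eventually_ge_atTop 4] with n hn
  have hn' : (4:ℝ) ≤ n := by exact_mod_cast hn
  have hl : 0 < Real.log n := Real.log_pos (by linarith)
  have hh : (2:ℝ) ≤ ((2 * n : ℕ) : ℝ) := by push_cast; linarith
  have hl2 : 0 < Real.log ((2 * n : ℕ) : ℝ) := Real.log_pos (by linarith)
  rw [← sub_div, div_mul_div_cancel₀ hl2.ne', ← add_div, div_div, div_le_div_iff₀ hl (by positivity)]
  have h := upper_log (n := 2 * n) (by omega)
  rw [show 2 * n / 2 = n by omega] at h
  have : -Real.log (th (pc 1) n) * 2 ≤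
    Real.log 8 + (Real.log (gy (pc 1) (2 * n)) - Real.log (ch (pc 1) (2 * n))) := by linarith
  have := mul_le_mul_of_nonneg_right this hl.le
  linarith

lemma half_lim {ρ : ℝ}
    (h : Tendsto (fun t : ℕ => -Real.log (th (pc 1) t) / Real.log t) atTop (𝓝 ρ)) :
    Tendsto (fun n : ℕ => (-Real.log (th (pc 1) (n / 2)) / Real.log ((n / 2 : ℕ) : ℝ)) *
          (Real.log ((n / 2 : ℕ) : ℝ) / Real.log n)) atTop (𝓝 ρ) := by
  have := (h.comp half_tend).mul ratio_half
  rw [mul_one] at this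
  exact this

theorem main_thm :
    (∀ ρ η : ℝ,
      Filter.Tendsto (fun t : ℕ => -Real.log (theta 1 (pc 1) t) / Real.log t)
        Filter.atTop (nhds ρ) →
      Filter.Tendsto (fun t : ℕ => Real.log (chi 1 (pc 1) t) / Real.log t)
        Filter.atTop (nhds η) →
      Filter.Tendsto (fun t : ℕ => Real.log (xi 1 (pc 1) t) / Real.log t)
        Filter.atTop (nhds (η + 2 * ρ))) ∧
    (∀ ρ ν : ℝ,
      Filter.Tendsto (fun t : ℕ => -Real.log (theta 1 (pc 1) t) / Real.log t)
        Filter.atTop (nhds ρ) →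
      Filter.Tendsto (fun t : ℕ => Real.log (xi 1 (pc 1) t) / Real.log t)
        Filter.atTop (nhds ν) →
      Filter.Tendsto (fun t : ℕ => Real.log (chi 1 (pc 1) t) / Real.log t)
        Filter.atTop (nhds (ν - 2 * ρ))) ∧
    (∀ η ν : ℝ,
      Filter.Tendsto (fun t : ℕ => Real.log (chi 1 (pc 1) t) / Real.log t)
        Filter.atTop (nhds η) →
      Filter.Tendsto (fun t : ℕ => Real.log (xi 1 (pc 1) t) / Real.log t)
        Filter.atTop (nhds ν) →
      Filter.Tendsto (fun t : ℕ => -Real.log (theta 1 (pc 1) t) / Real.log t)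
        Filter.atTop (nhds ((ν - η) / 2))) := by
  have hxi : ∀ n, xi 1 (pc 1) n = gy (pc 1) n := fun n => xi_eq (pc 1) n
  simp only [theta_eq, chi_eq, hxi]
  refine ⟨fun ρ η hρ hη => ?_, fun ρ ν hρ hν => ?_, fun η ν hη hν => ?_⟩
  · have hv := hη.add (hρ.const_mul 2)
    have hu := (hη.add ((half_lim hρ).const_mul 2)).sub (log_const_div (Real.log 8))
    rw [sub_zero] at hu
    refine squeeze_eps hu hv (fun ε hε => ?_) (fun ε hε => ?_)
    · filter_upwards [upper_ratio] with n h
      linarith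
    · filter_upwards [lower_ratio (poly_of_rho hρ) hε] with n h
      linarith
  · have hu := hν.sub (hρ.const_mul 2)
    have hv := (hν.sub ((half_lim hρ).const_mul 2)).add (log_const_div (Real.log 8))
    rw [add_zero] at hv
    refine squeeze_eps hu hv (fun ε hε => ?_) (fun ε hε => ?_)
    · filter_upwards [lower_ratio (poly_of_rho hρ) hε] with n h
      linarith
    · filter_upwards [upper_ratio] with n h
      linarith
  · have hu := (hν.sub hη).div_const 2
    have hv := ((log_const_div (Real.log 8)).add
      (((hν.comp dbl_tend).sub (hη.comp dbl_tend)).mul ratio_double)).div_const 2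
    rw [zero_add, mul_one] at hv
    refine squeeze_eps hu hv (fun ε hε => ?_) (fun ε hε => ?_)
    · filter_upwards [lower_ratio (poly_of_eta hη) hε] with n h
      linarith
    · filter_upwards [upper_ratio2] with n h
      simp only [Function.comp]
      linarith

/-- hyperscaling equality for `d = 1`: at `p = p_c` in one dimension,
if at least two of the three limits `ρ = lim (-log θ_t)/(log t)`, `η = lim (log χ_t)/(log t)`,
`ν = lim (log ξ_t)/(log t)` exist, then the third one also exists and `ν = η + 2ρ`. -/
theorem hyperscaling_equality_dim_one :
    (∀ ρ η : ℝ,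
      Filter.Tendsto (fun t : ℕ => -Real.log (theta 1 (pc 1) t) / Real.log t)
        Filter.atTop (nhds ρ) →
      Filter.Tendsto (fun t : ℕ => Real.log (chi 1 (pc 1) t) / Real.log t)
        Filter.atTop (nhds η) →
      Filter.Tendsto (fun t : ℕ => Real.log (xi 1 (pc 1) t) / Real.log t)
        Filter.atTop (nhds (η + 2 * ρ))) ∧
    (∀ ρ ν : ℝ,
      Filter.Tendsto (fun t : ℕ => -Real.log (theta 1 (pc 1) t) / Real.log t)
        Filter.atTop (nhds ρ) →
      Filter.Tendsto (fun t : ℕ => Real.log (xi 1 (pc 1) t) / Real.log t)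
        Filter.atTop (nhds ν) →
      Filter.Tendsto (fun t : ℕ => Real.log (chi 1 (pc 1) t) / Real.log t)
        Filter.atTop (nhds (ν - 2 * ρ))) ∧
    (∀ η ν : ℝ,
      Filter.Tendsto (fun t : ℕ => Real.log (chi 1 (pc 1) t) / Real.log t)
        Filter.atTop (nhds η) →
      Filter.Tendsto (fun t : ℕ => Real.log (xi 1 (pc 1) t) / Real.log t)
        Filter.atTop (nhds ν) →
      Filter.Tendsto (fun t : ℕ => -Real.log (theta 1 (pc 1) t) / Real.log t)
        Filter.atTop (nhds ((ν - η) / 2))) := by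
  exact main_thm

end OrientedPercolation
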